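/- Let p be a prime, r ≥ 0, and w ≥ 0. Then the matrix X^{(s,s)}_{p^r, w} is equivalent over ℤ to the diagonal Par(w)×Par(w)-matrix with diagonal entries p^{c_{p,r}(λ)}, λ ∈ Par(w); i.e., the elementary divisors of X^{(s,s)}_{p^r, w} are p^{c_{p,r}(λ)}, λ ∈ Par(w). -/

import Mathlib

open scoped BigOperators
open Classical

noncomputable section

/-- The number of maps `f` from the (indexed) parts of `mu` to the parts of `lam` such that for
every part `lam_i` of `lam`, the sum of the parts of `mu` in the fibre `f⁻¹(i)` equals `lam_i`.
This is `|𝓜_{λμ}|` and also the value of the permutation character `h_λ` on the class of cycle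
type `μ`. -/
def Mcount (lam mu : Multiset ℕ) : ℕ :=
  Fintype.card {f : Fin (Multiset.card mu) → Fin (Multiset.card lam) //
    ∀ i : Fin (Multiset.card lam),
      (∑ j ∈ Finset.univ.filter (fun j => f j = i), (mu.sort (· ≤ ·)).getD j 0)
        = (lam.sort (· ≤ ·)).getD i 0}

/-- `z_λ = ∏_i i^{m_i(λ)} m_i(λ)!`. -/
def zMult (lam : Multiset ℕ) : ℕ :=
  ∏ i ∈ lam.toFinset, i ^ lam.count i * (lam.count i).factorial

/-- The cycle type of a permutation of `Fin n`, as the multiset of parts of a partition of `n`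
(including the parts equal to `1` corresponding to fixed points). -/
def cycM {n : ℕ} (g : Equiv.Perm (Fin n)) : Multiset ℕ :=
  g.cycleType + Multiset.replicate (n - g.support.card) 1

/-- The value of the irreducible character `s_λ` of the symmetric group on the conjugacy class
of cycle type `nu`, given by the Jacobi–Trudi determinant `s_λ = det(h_{λ_i - i + j})_{i,j}`,
where `h_α` has value `Mcount α ν` on the class of cycle type `ν`. -/
def sval (lam nu : Multiset ℕ) : ℚ :=
  let L := (lam.sort (· ≤ ·)).reverse
  let l := Multiset.card lam
  ∑ σ : Equiv.Perm (Fin l),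
    ((Equiv.Perm.sign σ : ℤ) : ℚ) *
      (if ∀ i : Fin l, (i : ℕ) ≤ L.getD i 0 + (σ i : ℕ) then
        (Mcount ((Multiset.map (fun i : Fin l => L.getD i 0 + (σ i : ℕ) - (i : ℕ))
            (Finset.univ.val : Multiset (Fin l))).filter (fun x => x ≠ 0)) nu : ℚ)
       else 0)

/-- The irreducible character of `S_n` labelled by the partition `lam`, as a class function on
the symmetric group `S_n = Perm (Fin n)`. -/
def sFun {n : ℕ} (lam : Nat.Partition n) : Equiv.Perm (Fin n) → ℚ :=
  fun g => sval lam.parts (cycM g)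

/-- The usual scalar product of class functions on a finite group:
`⟨f, h⟩ = |G|⁻¹ ∑_{g ∈ G} f(g) h(g⁻¹)`. -/
def sp {G : Type*} [Group G] [Fintype G] (f h : G → ℚ) : ℚ :=
  (Fintype.card G : ℚ)⁻¹ * ∑ g : G, f g * h g⁻¹

/-- `d_p(k) = v_p(k!)`. -/
def dval (p k : ℕ) : ℕ := padicValNat p (Nat.factorial k)

/-- `c_{p,r}(λ) = ∑_{j ≥ 1, v_p(j) < r} ((r - v_p(j)) m_j(λ) + d_p(m_j(λ)))`. -/
def cpr (p r : ℕ) (lam : Multiset ℕ) : ℕ :=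
  ∑ j ∈ lam.toFinset.filter (fun j => padicValNat p j < r),
    ((r - padicValNat p j) * lam.count j + dval p (lam.count j))

/-- `ϑ_λ(ℓ) = ∏_{p^r ∥ ℓ} p^{c_{p,r}(λ)}`, with `ϑ_λ(0) = 0`. -/
def theta (lam : Multiset ℕ) (l : ℕ) : ℚ :=
  if l = 0 then 0 else ∏ q ∈ l.primeFactors, (q : ℚ) ^ cpr q (padicValNat q l) lam

/-- Two square matrices over `ℚ` (with possibly differently labelled index sets) are equivalent
over `ℤ` if one is obtained from the other by left and right multiplication by matrices
invertible over `ℤ`. -/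
def IntEquiv {T D : Type*} [Fintype T] [Fintype D] [DecidableEq T] [DecidableEq D]
    (A : Matrix T T ℚ) (B : Matrix D D ℚ) : Prop :=
  ∃ (e : T ≃ D) (U V : Matrix T T ℤ), IsUnit U ∧ IsUnit V ∧
    (U.map (fun x : ℤ => (x : ℚ))) * A * (V.map (fun x : ℤ => (x : ℚ))) = B.submatrix e e

/-- The matrix `X^{(s,s)}_{ℓ,w}` with `(λ,μ)`-entry
`∑_{ν ∈ Par(w)} z_ν⁻¹ s_λ(g_ν) s_μ(g_ν) ℓ^{l(ν)}`. -/
def Xmat (l : ℤ) (w : ℕ) : Matrix (Nat.Partition w) (Nat.Partition w) ℚ :=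
  Matrix.of fun lam mu => ∑ nu : Nat.Partition w,
    (zMult nu.parts : ℚ)⁻¹ * sval lam.parts nu.parts * sval mu.parts nu.parts *
      (l : ℚ) ^ (Multiset.card nu.parts)


theorem la_smith {ι : Type*} [Fintype ι] [DecidableEq ι] (A : Matrix ι ι ℤ) (hA : A.det ≠ 0) :
    ∃ (P C : Matrix ι ι ℤ) (a : ι → ℤ), IsUnit P ∧ IsUnit C ∧ A * C = P * Matrix.diagonal a := by
  have hinj : Function.Injective A.mulVecLin := by
    intro x y hxy
    exact Matrix.mulVec_injective_of_det_ne_zero hA hxy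
  let e := LinearEquiv.ofInjective A.mulVecLin hinj
  have hr : Module.finrank ℤ (LinearMap.range A.mulVecLin) = Module.finrank ℤ (ι → ℤ) :=
    (LinearEquiv.finrank_eq e).symm
  obtain ⟨b', a, ab', h⟩ := Submodule.exists_smith_normal_form_of_rank_eq (Pi.basisFun ℤ ι) hr
  let c := ab'.map e.symm
  have hc : ∀ i, A.mulVec (c i) = a i • b' i := by
    intro i
    rw [← h i]
    have : e (c i) = ab' i := by simp [c]
    rw [← this]
    rfl
  refine ⟨(Pi.basisFun ℤ ι).toMatrix b', (Pi.basisFun ℤ ι).toMatrix c, a, ?_, ?_, ?_⟩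
  · let := (Pi.basisFun ℤ ι).invertibleToMatrix b'
    exact isUnit_of_invertible _
  · let := (Pi.basisFun ℤ ι).invertibleToMatrix c
    exact isUnit_of_invertible _
  · ext i j
    have := congrFun (hc j) i
    rw [Matrix.mul_diagonal, Matrix.mul_apply]
    simp only [Module.Basis.toMatrix_apply, Pi.basisFun_repr]
    simp only [Matrix.mulVec, dotProduct, Pi.smul_apply, smul_eq_mul] at this
    rw [this, mul_comm]

theorem la_main {ι : Type*} [Fintype ι] [DecidableEq ι] (p : ℕ) (hp : p.Prime)
    (A T Y : Matrix ι ι ℤ) (c : ι → ℕ)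
    (h : T * A = Matrix.diagonal (fun i => (p : ℤ) ^ c i) * Y)
    (hT : ¬ (p : ℤ) ∣ T.det) (hA : A.det = (p : ℤ) ^ (∑ i, c i)) :
    ∃ (e : ι ≃ ι) (U V : Matrix ι ι ℤ), IsUnit U ∧ IsUnit V ∧
      U * A * V = Matrix.diagonal (fun i => (p : ℤ) ^ c (e i)) := by
  have hpZ : Prime (p : ℤ) := Nat.prime_iff_prime_int.mp hp
  have hp0 : (p : ℤ) ≠ 0 := hpZ.ne_zero
  obtain ⟨P, C, a, hP, hC, hAC⟩ := la_smith A (by rw [hA]; positivity)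
  have hPd : IsUnit P.det := (Matrix.isUnit_iff_isUnit_det _).1 hP
  have hCd : IsUnit C.det := (Matrix.isUnit_iff_isUnit_det _).1 hC
  have hdet : A.det * C.det = P.det * ∏ i, a i := by
    rw [← Matrix.det_mul, hAC, Matrix.det_mul, Matrix.det_diagonal]
  have hprod : (∏ i, (a i).natAbs) = p ^ (∑ i, c i) := by
    have := congrArg Int.natAbs hdet
    rw [Int.natAbs_mul, Int.natAbs_mul, Int.natAbs_of_isUnit hCd, Int.natAbs_of_isUnit hPd, hA] at this
    simp only [Int.natAbs_pow, Int.natAbs_natCast, mul_one, one_mul] at this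
    rw [this]
    exact (map_prod Int.natAbsHom a Finset.univ).symm
  have ha : ∀ i, ∃ k, (a i).natAbs = p ^ k := by
    intro i
    have : (a i).natAbs ∣ p ^ (∑ i, c i) := by
      rw [← hprod]; exact Finset.dvd_prod_of_mem _ (Finset.mem_univ i)
    obtain ⟨k, _, hk⟩ := (Nat.dvd_prime_pow hp).1 this
    exact ⟨k, hk⟩
  choose e he using ha
  have hsum : ∑ i, e i = ∑ i, c i := by
    simp_rw [he, Finset.prod_pow_eq_pow_sum] at hprod
    exact Nat.pow_right_injective hp.two_le hprod
  have hTP : T * P * Matrix.diagonal a = Matrix.diagonal (fun i => (p : ℤ) ^ c i) * (Y * C) := by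
    rw [Matrix.mul_assoc, ← hAC, ← Matrix.mul_assoc, h, Matrix.mul_assoc]
  have hT' : ¬ (p : ℤ) ∣ (T * P).det := by
    rw [Matrix.det_mul]
    intro hd
    rcases hpZ.dvd_or_dvd hd with h1 | h1
    · exact hT h1
    · exact hpZ.not_isUnit (isUnit_of_dvd_unit h1 hPd)
  obtain ⟨σ, hσ⟩ : ∃ σ : Equiv.Perm ι, ∀ i, ¬ (p : ℤ) ∣ (T * P) (σ i) i := by
    by_contra hcon
    push Not at hcon
    apply hT'
    rw [Matrix.det_apply']
    refine Finset.dvd_sum fun σ _ => ?_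
    obtain ⟨i, hi⟩ := hcon σ
    exact Dvd.dvd.mul_left (hi.trans (Finset.dvd_prod_of_mem (fun j => (T * P) (σ j) j) (Finset.mem_univ i))) _
  have hle : ∀ i, c (σ i) ≤ e i := by
    intro i
    have h1 := congrFun (congrFun hTP (σ i)) i
    rw [Matrix.mul_diagonal, Matrix.diagonal_mul] at h1
    have h2 : (p : ℤ) ^ c (σ i) ∣ (T * P) (σ i) i * a i := ⟨_, h1⟩
    have h3 : IsCoprime ((p : ℤ) ^ c (σ i)) ((T * P) (σ i) i) :=
      ((Prime.coprime_iff_not_dvd hpZ).2 (hσ i)).pow_left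
    have h4 := h3.dvd_of_dvd_mul_left h2
    have h5 := Int.natAbs_dvd_natAbs.2 h4
    rw [he i, Int.natAbs_pow, Int.natAbs_natCast] at h5
    exact (Nat.pow_dvd_pow_iff_le_right hp.one_lt).1 h5
  have heq : ∀ i, c (σ i) = e i := by
    have : ∑ i, c (σ i) = ∑ i, e i := by rw [hsum]; exact Equiv.sum_comp σ c
    intro i
    exact (Finset.sum_eq_sum_iff_of_le (fun i _ => hle i)).1 this i (Finset.mem_univ i)
  have hs : ∀ i, ∃ s : ℤ, IsUnit s ∧ a i * s = (p : ℤ) ^ c (σ i) := by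
    intro i
    rw [heq i]
    rcases Int.natAbs_eq (a i) with h1 | h1
    · exact ⟨1, isUnit_one, by rw [h1, he i]; push_cast; ring⟩
    · exact ⟨-1, isUnit_one.neg, by rw [h1, he i]; push_cast; ring⟩
  choose s hs1 hs2 using hs
  refine ⟨σ, P⁻¹, C * Matrix.diagonal s, ?_, ?_, ?_⟩
  · exact Matrix.isUnit_nonsing_inv_iff.2 hP
  · refine hC.mul ?_
    rw [Matrix.isUnit_iff_isUnit_det, Matrix.det_diagonal]
    exact IsUnit.prod_univ_iff.2 hs1
  · rw [Matrix.mul_assoc, ← Matrix.mul_assoc A, hAC, ← Matrix.mul_assoc, ← Matrix.mul_assoc,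
      Matrix.nonsing_inv_mul _ hPd, Matrix.one_mul, Matrix.diagonal_mul_diagonal]
    congr 1
    ext i
    exact hs2 i



def ptCnt (w n : ℕ) : ℕ := if n ≤ w then Fintype.card (Nat.Partition (w - n)) else 0

theorem pt_card (w i j : ℕ) (hj : 1 ≤ j) :
    (Finset.univ.filter (fun lam : Nat.Partition w => i ≤ lam.parts.count j)).card
      = ptCnt w (j * i) := by
  unfold ptCnt
  split_ifs with h
  · rw [← Finset.card_univ]
    symm
    refine Finset.card_bij' (fun mu _ => ⟨mu.parts + Multiset.replicate i j, ?_, ?_⟩)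
      (fun lam hl => ⟨lam.parts - Multiset.replicate i j, ?_, ?_⟩) ?_ ?_ ?_ ?_
    · intro a ha
      rcases Multiset.mem_add.1 ha with h1 | h1
      · exact mu.parts_pos h1
      · rw [Multiset.eq_of_mem_replicate h1]; exact hj
    · rw [Multiset.sum_add, mu.parts_sum, Multiset.sum_replicate, smul_eq_mul, mul_comm i j]
      omega
    · intro a ha
      exact lam.parts_pos (Multiset.mem_of_le (Multiset.sub_le_self _ _) ha)
    · have h1 : Multiset.replicate i j ≤ lam.parts :=
        Multiset.le_count_iff_replicate_le.1 (Finset.mem_filter.1 hl).2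
      have h2 := congrArg Multiset.sum (tsub_add_cancel_of_le h1)
      rw [Multiset.sum_add, lam.parts_sum, Multiset.sum_replicate, smul_eq_mul, mul_comm i j] at h2
      omega
    · intro mu _
      simp
    · intro lam _
      simp
    · intro mu _
      ext1
      simp
    · intro lam hl
      have h1 : Multiset.replicate i j ≤ lam.parts :=
        Multiset.le_count_iff_replicate_le.1 (Finset.mem_filter.1 hl).2
      ext1
      exact tsub_add_cancel_of_le h1
  · rw [Finset.card_eq_zero, Finset.filter_eq_empty_iff]
    intro lam _ hi
    have h1 : Multiset.replicate i j ≤ lam.parts := Multiset.le_count_iff_replicate_le.1 hi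
    have h2 := congrArg Multiset.sum (tsub_add_cancel_of_le h1)
    rw [Multiset.sum_add, lam.parts_sum, Multiset.sum_replicate, smul_eq_mul, mul_comm i j] at h2
    omega

theorem pt_part_le {w : ℕ} (lam : Nat.Partition w) {j : ℕ} (hj : j ∈ lam.parts) : j ≤ w := by
  rw [← lam.parts_sum]; exact Multiset.le_sum_of_mem hj

theorem pt_count_le {w : ℕ} (lam : Nat.Partition w) (j : ℕ) (hj : 1 ≤ j) :
    lam.parts.count j ≤ w := by
  have h1 : Multiset.replicate (lam.parts.count j) j ≤ lam.parts :=
    Multiset.le_count_iff_replicate_le.1 le_rfl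
  have h2 := congrArg Multiset.sum (tsub_add_cancel_of_le h1)
  rw [Multiset.sum_add, lam.parts_sum, Multiset.sum_replicate, smul_eq_mul] at h2
  have h3 := Nat.le_mul_of_pos_right (lam.parts.count j) hj
  omega

theorem pt_prod {M : Type*} [CommMonoid M] (w : ℕ) (f : ℕ → ℕ → M) :
    ∏ lam : Nat.Partition w, ∏ j ∈ lam.parts.toFinset,
        ∏ i ∈ Finset.Icc 1 (lam.parts.count j), f j i
      = ∏ n ∈ Finset.Icc 1 w, (∏ x ∈ n.divisorsAntidiagonal, f x.1 x.2) ^ ptCnt w n := by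
  have h1 : ∀ lam : Nat.Partition w, (∏ j ∈ lam.parts.toFinset,
        ∏ i ∈ Finset.Icc 1 (lam.parts.count j), f j i)
      = ∏ x ∈ (Finset.Icc 1 w ×ˢ Finset.Icc 1 w), 
          (if x.2 ≤ lam.parts.count x.1 then f x.1 x.2 else 1) := by
    intro lam
    rw [Finset.prod_product]
    have hsub : lam.parts.toFinset ⊆ Finset.Icc 1 w := by
      intro j hj
      rw [Multiset.mem_toFinset] at hj
      exact Finset.mem_Icc.2 ⟨lam.parts_pos hj, pt_part_le lam hj⟩
    rw [← Finset.prod_subset hsub]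
    · refine Finset.prod_congr rfl fun j hj => ?_
      have hj1 := Finset.mem_Icc.1 (hsub hj)
      rw [← Finset.prod_filter]
      refine Finset.prod_congr ?_ fun _ _ => rfl
      ext i
      have := pt_count_le lam j hj1.1
      simp only [Finset.mem_Icc, Finset.mem_filter]
      omega
    · intro j _ hj
      rw [Multiset.mem_toFinset] at hj
      refine Finset.prod_eq_one fun i hi => ?_
      have := Finset.mem_Icc.1 hi
      rw [Multiset.count_eq_zero_of_notMem hj, if_neg]
      simp only
      omega
  simp_rw [h1]
  rw [Finset.prod_comm]
  have h2 : ∀ x ∈ (Finset.Icc 1 w ×ˢ Finset.Icc 1 w),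
      (∏ lam : Nat.Partition w, (if x.2 ≤ lam.parts.count x.1 then f x.1 x.2 else 1))
        = f x.1 x.2 ^ ptCnt w (x.1 * x.2) := by
    intro x hx
    rw [← Finset.prod_filter, Finset.prod_const, pt_card]
    exact (Finset.mem_Icc.1 (Finset.mem_product.1 hx).1).1
  rw [Finset.prod_congr rfl h2]
  have h3 : ∏ x ∈ (Finset.Icc 1 w ×ˢ Finset.Icc 1 w), f x.1 x.2 ^ ptCnt w (x.1 * x.2)
     = ∏ x ∈ (Finset.Icc 1 w ×ˢ Finset.Icc 1 w).filter (fun x => x.1 * x.2 ≤ w),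
         f x.1 x.2 ^ ptCnt w (x.1 * x.2) := by
    symm
    apply Finset.prod_filter_of_ne
    intro x _ hx
    by_contra hc
    apply hx
    rw [ptCnt, if_neg hc, pow_zero]
  rw [h3, ← Finset.prod_fiberwise_of_maps_to (g := fun x => x.1 * x.2) (t := Finset.Icc 1 w)]
  · refine Finset.prod_congr rfl fun n hn => ?_
    rw [← Finset.prod_pow]
    have hn := Finset.mem_Icc.1 hn
    refine Finset.prod_congr ?_ ?_
    · ext ⟨a, b⟩
      simp only [Finset.mem_filter, Finset.mem_product, Finset.mem_Icc, Nat.mem_divisorsAntidiagonal]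
      constructor
      · rintro ⟨⟨⟨⟨_, _⟩, _, _⟩, _⟩, h⟩
        exact ⟨h, by omega⟩
      · rintro ⟨h, _⟩
        have ha : 1 ≤ a := by rcases Nat.eq_zero_or_pos a with h0 | h0; (subst h0; omega); exact h0
        have hb : 1 ≤ b := by rcases Nat.eq_zero_or_pos b with h0 | h0; (subst h0; omega); exact h0
        exact ⟨⟨⟨⟨ha, by nlinarith⟩, hb, by nlinarith⟩, by omega⟩, h⟩
    · intro x hx
      rw [(Nat.mem_divisorsAntidiagonal.1 hx).1]
  · intro x hx
    simp only [Finset.mem_filter, Finset.mem_product, Finset.mem_Icc] at hx ⊢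
    exact ⟨Nat.mul_pos (by omega) (by omega), hx.2⟩

theorem pt_icc_fact (m : ℕ) : ∏ i ∈ Finset.Icc 1 m, i = m.factorial := by
  induction m with
  | zero => simp
  | succ m ih => rw [Finset.prod_Icc_succ_top (by omega), ih, Nat.factorial_succ, mul_comm]

theorem pt_fact (w : ℕ) :
    ∏ lam : Nat.Partition w, ∏ j ∈ lam.parts.toFinset, (lam.parts.count j).factorial
      = ∏ lam : Nat.Partition w, ∏ j ∈ lam.parts.toFinset, j ^ lam.parts.count j := by
  have h1 := pt_prod w (fun _ i => i)
  have h2 := pt_prod w (fun j _ => j)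
  simp only [Finset.prod_const, Nat.card_Icc, Nat.add_sub_cancel, pt_icc_fact] at h1 h2
  rw [h1, h2]
  refine Finset.prod_congr rfl fun n _ => ?_
  congr 1
  conv_lhs => rw [← Nat.map_swap_divisorsAntidiagonal, Finset.prod_map]
  rfl

theorem pt_range (r a : ℕ) :
    ∑ c ∈ Finset.range (a + 1), (if c < r then r - c + (a - c) else 0) = r * (a + 1) := by
  induction r with
  | zero => simp
  | succ r ih =>
    have : ∀ c ∈ Finset.range (a + 1), (if c < r + 1 then r + 1 - c + (a - c) else 0)
        = (if c < r then r - c + (a - c) else 0) + ((if c < r then 1 else 0) +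
          (if c = r then 1 + (a - r) else 0)) := by
      intro c _
      split_ifs <;> omega
    rw [Finset.sum_congr rfl this, Finset.sum_add_distrib, ih, Finset.sum_add_distrib,
      Finset.sum_ite_eq', Finset.sum_boole]
    have h2 : ((Finset.range (a + 1)).filter (fun c => c < r)) = Finset.range (min (a+1) r) := by
      ext c; simp
    rw [h2]
    simp only [Finset.card_range, Finset.mem_range, Nat.cast_id]
    rw [add_mul]
    split_ifs <;> omega

theorem pt_div (p : ℕ) (hp : p.Prime) (r n : ℕ) (hn : n ≠ 0) :
    ∑ x ∈ n.divisorsAntidiagonal,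
      (if padicValNat p x.1 < r then r - padicValNat p x.1 + padicValNat p x.2 else 0)
      = ∑ x ∈ n.divisorsAntidiagonal, r := by
  have := Fact.mk hp
  obtain ⟨a, b, hb, rfl⟩ := Nat.exists_eq_pow_mul_and_not_dvd hn p hp.ne_one
  have hb0 : b ≠ 0 := by rintro rfl; simp at hb
  have key : ∀ g : ℕ → ℕ → ℕ, ∑ x ∈ (p ^ a * b).divisorsAntidiagonal, g (padicValNat p x.1) (padicValNat p x.2)
      = ∑ y ∈ Finset.range (a + 1) ×ˢ b.divisorsAntidiagonal, g y.1 (a - y.1) := by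
    intro g
    symm
    refine Finset.sum_bij (fun y _ => (p ^ y.1 * y.2.1, p ^ (a - y.1) * y.2.2)) ?_ ?_ ?_ ?_
    · rintro ⟨c, d, e⟩ h
      simp only [Finset.mem_product, Finset.mem_range, Nat.mem_divisorsAntidiagonal] at h ⊢
      refine ⟨?_, hn⟩
      rw [← h.2.1]
      have : p ^ a = p ^ c * p ^ (a - c) := by rw [← pow_add]; congr 1; omega
      rw [this]; ring
    · rintro ⟨c, d, e⟩ h ⟨c', d', e'⟩ h' heq
      simp only [Finset.mem_product, Finset.mem_range, Nat.mem_divisorsAntidiagonal] at h h'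
      simp only [Prod.mk.injEq] at heq
      have hv : ∀ c d e : ℕ, d * e = b → padicValNat p (p ^ c * d) = c := by
        intro c d e h
        have hd : ¬ p ∣ d := fun hh => hb (h ▸ hh.mul_right e)
        have hd0 : d ≠ 0 := by rintro rfl; simp at hd
        rw [padicValNat.mul (pow_ne_zero _ hp.ne_zero) hd0, padicValNat.prime_pow,
          padicValNat.eq_zero_of_not_dvd hd, add_zero]
      have hc : c = c' := by
        rw [← hv c d e h.2.1, heq.1, hv c' d' e' h'.2.1]
      subst hc
      have h1 := Nat.eq_of_mul_eq_mul_left (pow_pos hp.pos _) heq.1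
      have h2 := Nat.eq_of_mul_eq_mul_left (pow_pos hp.pos _) heq.2
      rw [h1, h2]
    · rintro ⟨x, y⟩ h
      obtain ⟨h, _⟩ := Nat.mem_divisorsAntidiagonal.1 h
      simp only at h
      have hx0 : x ≠ 0 := by rintro rfl; simp [hb0, hp.ne_zero] at h; 
      have hy0 : y ≠ 0 := by rintro rfl; simp [hb0, hp.ne_zero] at h; 
      obtain ⟨c, d, hd, rfl⟩ := Nat.exists_eq_pow_mul_and_not_dvd hx0 p hp.ne_one
      obtain ⟨c', d', hd', rfl⟩ := Nat.exists_eq_pow_mul_and_not_dvd hy0 p hp.ne_one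
      have hdd : ¬ p ∣ d * d' := fun hh => (hp.dvd_mul.1 hh).elim hd hd'
      have h1 : p ^ (c + c') * (d * d') = p ^ a * b := by rw [← h, pow_add]; ring
      have hv := congrArg (padicValNat p) h1
      have hdd0 : d * d' ≠ 0 := by intro h0; rw [h0] at hdd; simp at hdd
      rw [padicValNat.mul (pow_ne_zero _ hp.ne_zero) hdd0, padicValNat.prime_pow,
          padicValNat.eq_zero_of_not_dvd hdd, padicValNat.mul (pow_ne_zero _ hp.ne_zero) hb0,
          padicValNat.prime_pow, padicValNat.eq_zero_of_not_dvd hb, add_zero, add_zero] at hv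
      rw [hv] at h1
      have h2 := Nat.eq_of_mul_eq_mul_left (pow_pos hp.pos _) h1
      refine ⟨(c, d, d'), ?_, ?_⟩
      · simp only [Finset.mem_product, Finset.mem_range, Nat.mem_divisorsAntidiagonal]
        exact ⟨by omega, h2, hb0⟩
      · simp only
        have : a - c = c' := by omega
        rw [this]
    · rintro ⟨c, d, e⟩ h
      simp only [Finset.mem_product, Finset.mem_range, Nat.mem_divisorsAntidiagonal] at h
      have hd : ¬ p ∣ d := fun hh => hb (h.2.1 ▸ hh.mul_right e)
      have hd0 : d ≠ 0 := by rintro rfl; simp at hd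
      have he : ¬ p ∣ e := fun hh => hb (h.2.1 ▸ hh.mul_left d)
      have he0 : e ≠ 0 := by rintro rfl; simp at he
      simp only
      rw [padicValNat.mul (pow_ne_zero _ hp.ne_zero) hd0, padicValNat.prime_pow,
          padicValNat.eq_zero_of_not_dvd hd, padicValNat.mul (pow_ne_zero _ hp.ne_zero) he0,
          padicValNat.prime_pow, padicValNat.eq_zero_of_not_dvd he, add_zero, add_zero]
  rw [key (fun c d => if c < r then r - c + d else 0), key (fun _ _ => r)]
  rw [Finset.sum_product_right, Finset.sum_product_right]
  refine Finset.sum_congr rfl fun x _ => ?_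
  simp only
  rw [pt_range]
  simp [mul_comm]

theorem pt_val_fact (p : ℕ) (hp : p.Prime) (m : ℕ) :
    ∑ i ∈ Finset.Icc 1 m, padicValNat p i = padicValNat p m.factorial := by
  have := Fact.mk hp
  induction m with
  | zero => simp
  | succ m ih =>
    rw [Finset.sum_Icc_succ_top (by omega), ih, Nat.factorial_succ,
      padicValNat.mul (by omega) (Nat.factorial_ne_zero m), add_comm]




theorem pt_cpr (p : ℕ) (hp : p.Prime) (r w : ℕ) :
    ∏ lam : Nat.Partition w, p ^ cpr p r lam.parts
      = ∏ lam : Nat.Partition w, (p ^ r) ^ Multiset.card lam.parts := by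
  have h1 := pt_prod w (fun j i => p ^ (if padicValNat p j < r then r - padicValNat p j + padicValNat p i else 0))
  have h2 := pt_prod w (fun _ _ => p ^ r)
  have e1 : ∀ lam : Nat.Partition w, p ^ cpr p r lam.parts = ∏ j ∈ lam.parts.toFinset,
        ∏ i ∈ Finset.Icc 1 (lam.parts.count j),
          p ^ (if padicValNat p j < r then r - padicValNat p j + padicValNat p i else 0) := by
    intro lam
    simp only [Finset.prod_pow_eq_pow_sum]
    congr 1
    unfold cpr
    rw [Finset.sum_filter]
    refine Finset.sum_congr rfl fun j _ => ?_
    split_ifs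
    · rw [Finset.sum_add_distrib, pt_val_fact p hp, dval]
      simp [mul_comm]
    · simp
  have e2 : ∀ lam : Nat.Partition w, (p ^ r) ^ Multiset.card lam.parts = ∏ j ∈ lam.parts.toFinset,
        ∏ i ∈ Finset.Icc 1 (lam.parts.count j), p ^ r := by
    intro lam
    simp only [Finset.prod_const, Nat.card_Icc, Nat.add_sub_cancel, Finset.prod_pow_eq_pow_sum,
      Multiset.toFinset_sum_count_eq]
  simp_rw [e1, e2]
  rw [h1, h2]
  refine Finset.prod_congr rfl fun n hn => ?_
  congr 1
  rw [Finset.prod_pow_eq_pow_sum, Finset.prod_pow_eq_pow_sum, pt_div p hp r n]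
  have := Finset.mem_Icc.1 hn
  omega




theorem la_tri {ι R : Type*} [Fintype ι] [DecidableEq ι] [CommRing R] (M : Matrix ι ι R) (b : ι → ℕ)
    (h : ∀ i j, i ≠ j → M i j ≠ 0 → b i < b j) : M.det = ∏ i, M i i := by
  rw [Matrix.det_apply', Finset.sum_eq_single 1]
  · simp
  · intro σ _ hσ
    have : ∃ i, M (σ i) i = 0 := by
      by_contra hc
      push Not at hc
      have hle : ∀ i, b (σ i) ≤ b i := by
        intro i
        by_cases hi : σ i = i
        · rw [hi]
        · exact (h _ _ hi (hc i)).le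
      have hs : ∑ i, b (σ i) = ∑ i, b i := Equiv.sum_comp σ b
      have := (Finset.sum_eq_sum_iff_of_le (fun i _ => hle i)).1 hs
      apply hσ
      ext i
      by_contra hi
      rw [Equiv.Perm.one_apply] at hi
      have h1 := h _ _ hi (hc i)
      have h2 := this i (Finset.mem_univ i)
      omega
    obtain ⟨i, hi⟩ := this
    rw [Finset.prod_eq_zero (f := fun i => M (σ i) i) (Finset.mem_univ i) hi, mul_zero]
  · simp

def pf (lam : Multiset ℕ) : Fin (Multiset.card lam) → ℕ := fun j => (lam.sort (· ≤ ·)).getD j 0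

theorem pf_map (lam : Multiset ℕ) : Multiset.map (pf lam) Finset.univ.val = lam := by
  conv_rhs => rw [← Multiset.sort_eq lam (· ≤ ·)]
  rw [Fin.univ_val_map]
  congr 1
  apply List.ext_getElem
  · simp
  · intro i h1 h2
    simp only [List.getElem_ofFn, pf]
    exact List.getD_eq_getElem _ _ h2

theorem pf_mem (lam : Multiset ℕ) (j) : pf lam j ∈ lam := by
  have h : pf lam j ∈ Multiset.map (pf lam) Finset.univ.val :=
    Multiset.mem_map_of_mem _ (Finset.mem_univ j)
  rwa [pf_map] at h

theorem Mcount_eq (lam mu : Multiset ℕ) : Mcount lam mu =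
    Fintype.card {f : Fin (Multiset.card mu) → Fin (Multiset.card lam) //
      ∀ i, (∑ j ∈ Finset.univ.filter (fun j => f j = i), pf mu j) = pf lam i} := rfl

theorem Mc_surj (lam mu : Multiset ℕ) (hl : ∀ i ∈ lam, 0 < i)
    (f : Fin (Multiset.card mu) → Fin (Multiset.card lam))
    (hf : ∀ i, (∑ j ∈ Finset.univ.filter (fun j => f j = i), pf mu j) = pf lam i) :
    Function.Surjective f := by
  intro i
  by_contra hc
  push Not at hc
  have h1 := hf i
  rw [Finset.filter_false_of_mem (fun j _ => hc j), Finset.sum_empty] at h1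
  have := hl _ (pf_mem lam i)
  omega

theorem Mc_inj (lam mu : Multiset ℕ)
    (f : Fin (Multiset.card mu) → Fin (Multiset.card lam)) (hinj : Function.Injective f)
    (hf : ∀ i, (∑ j ∈ Finset.univ.filter (fun j => f j = i), pf mu j) = pf lam i) (j) :
    pf lam (f j) = pf mu j := by
  rw [← hf]
  have : Finset.univ.filter (fun j' => f j' = f j) = {j} := by
    ext j'; simp [hinj.eq_iff]
  rw [this, Finset.sum_singleton]

theorem Mc_tri (lam mu : Multiset ℕ) (hl : ∀ i ∈ lam, 0 < i) (hne : lam ≠ mu)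
    (h : Mcount lam mu ≠ 0) : Multiset.card lam < Multiset.card mu := by
  rw [Mcount_eq] at h
  replace h := Fintype.card_pos_iff.1 (Nat.pos_of_ne_zero h)
  obtain ⟨f, hf⟩ := h
  have hs := Mc_surj lam mu hl f hf
  have hle : Multiset.card lam ≤ Multiset.card mu := by
    simpa using Fintype.card_le_of_surjective f hs
  refine lt_of_le_of_ne hle fun hc => hne ?_
  have hb : Function.Bijective f := (Fintype.bijective_iff_surjective_and_card f).2 ⟨hs, by simp [hc]⟩
  have h1 := Mc_inj lam mu f hb.1 hf
  rw [← pf_map lam, ← pf_map mu]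
  have h2 : pf mu = pf lam ∘ f := by ext j; exact (h1 j).symm
  rw [h2, ← Multiset.map_map]
  congr 1
  have := Finset.map_univ_equiv (Equiv.ofBijective f hb)
  have h3 : Multiset.map f Finset.univ.val = Finset.univ.val := congrArg Finset.val this
  exact h3.symm

theorem Mc_diag (lam : Multiset ℕ) (hl : ∀ i ∈ lam, 0 < i) :
    Mcount lam lam = ∏ j ∈ lam.toFinset, (lam.count j).factorial := by
  rw [Mcount_eq]
  have e : {f : Fin (Multiset.card lam) → Fin (Multiset.card lam) //
      ∀ i, (∑ j ∈ Finset.univ.filter (fun j => f j = i), pf lam j) = pf lam i} ≃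
      {g : Equiv.Perm (Fin (Multiset.card lam)) // pf lam ∘ g = pf lam} :=
    { toFun := fun f => ⟨Equiv.ofBijective f.1
          (Finite.surjective_iff_bijective.1 (Mc_surj lam lam hl f.1 f.2)), by
          ext j
          exact Mc_inj lam lam f.1
            (Finite.surjective_iff_bijective.1 (Mc_surj lam lam hl f.1 f.2)).1 f.2 j⟩
      invFun := fun g => ⟨g.1, by
        intro i
        have : Finset.univ.filter (fun j => g.1 j = i) = {g.1.symm i} := by
          ext j; simp [Equiv.eq_symm_apply]
        rw [this, Finset.sum_singleton]
        have := congrFun g.2 (g.1.symm i)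
        simpa using this.symm⟩
      left_inv := fun f => by ext; rfl
      right_inv := fun g => by ext; rfl }
  rw [Fintype.card_congr e]
  have h1 := DomMulAct.stabilizer_card' (pf lam)
  have him : Finset.image (pf lam) Finset.univ = lam.toFinset := by
    conv_rhs => rw [← pf_map lam]
    rfl
  rw [him] at h1
  convert h1 using 1
  refine Finset.prod_congr rfl fun i _ => ?_
  congr 1
  rw [Fintype.card_subtype]
  conv_lhs => rw [← pf_map lam]
  rw [Multiset.count_map]
  rw [Finset.card_def, Finset.filter_val]
  simp only [eq_comm]



def jtL (lam : Multiset ℕ) : Fin (Multiset.card lam) → ℕ :=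
  fun i => ((lam.sort (· ≤ ·)).reverse).getD i 0

def jtA (lam : Multiset ℕ) (σ : Equiv.Perm (Fin (Multiset.card lam))) : Multiset ℕ :=
  (Multiset.map (fun i : Fin (Multiset.card lam) => jtL lam i + (σ i : ℕ) - (i : ℕ)) Finset.univ.val).filter (fun x => x ≠ 0)

def jtV (lam : Multiset ℕ) (σ : Equiv.Perm (Fin (Multiset.card lam))) : Prop :=
  ∀ i : Fin (Multiset.card lam), (i : ℕ) ≤ jtL lam i + (σ i : ℕ)

theorem sval_eq (lam nu : Multiset ℕ) : sval lam nu =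
    ∑ σ : Equiv.Perm (Fin (Multiset.card lam)), ((Equiv.Perm.sign σ : ℤ) : ℚ) *
      (if jtV lam σ then (Mcount (jtA lam σ) nu : ℚ) else 0) := by
  unfold sval
  refine Finset.sum_congr rfl fun σ _ => ?_
  congr 1
  exact if_congr Iff.rfl rfl rfl

theorem jtL_map (lam : Multiset ℕ) : Multiset.map (jtL lam) Finset.univ.val = lam := by
  have h0 : (((lam.sort (· ≤ ·)).reverse : List ℕ) : Multiset ℕ) = lam := by
    conv_rhs => rw [← Multiset.sort_eq lam (· ≤ ·)]
    simp
  conv_rhs => rw [← h0]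
  rw [Fin.univ_val_map]
  congr 1
  apply List.ext_getElem
  · simp
  · intro i h1 h2
    simp only [List.getElem_ofFn, jtL]
    exact List.getD_eq_getElem _ _ h2

theorem jtL_anti (lam : Multiset ℕ) : Antitone (jtL lam) := by
  intro i j hij
  have hs : ((lam.sort (· ≤ ·)).reverse).Pairwise (fun a b => b ≤ a) := by
    rw [List.pairwise_reverse]
    exact Multiset.pairwise_sort _ _
  have hlen : ((lam.sort (· ≤ ·)).reverse).length = Multiset.card lam := by simp
  rcases eq_or_lt_of_le hij with h | h
  · rw [h]
  · unfold jtL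
    rw [List.getD_eq_getElem _ _ (by rw [hlen]; exact j.2), List.getD_eq_getElem _ _ (by rw [hlen]; exact i.2)]
    exact List.pairwise_iff_getElem.1 hs _ _ _ _ h

theorem jt_filter_sum (s : Multiset ℕ) (g : ℕ → ℕ) (hg : g 0 = 0) :
    ((s.filter (fun x => x ≠ 0)).map g).sum = (s.map g).sum := by
  induction s using Multiset.induction_on with
  | empty => simp
  | cons a s ih =>
    by_cases ha : a = 0
    · subst ha; simpa [hg] using ih
    · rw [Multiset.filter_cons_of_pos (p := fun x => x ≠ 0) _ ha]; simpa using ih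

theorem jt_sum (lam : Multiset ℕ) (σ : Equiv.Perm (Fin (Multiset.card lam))) (h : jtV lam σ) :
    (jtA lam σ).sum = lam.sum := by
  have h1 := jt_filter_sum (Multiset.map (fun i : Fin (Multiset.card lam) => jtL lam i + (σ i : ℕ) - (i : ℕ)) Finset.univ.val) id rfl
  simp only [Multiset.map_id] at h1
  rw [jtA, h1]
  conv_rhs => rw [← jtL_map lam]
  change ∑ i, _ = ∑ i, _
  have h2 : ∑ i, (jtL lam i + (σ i : ℕ) - (i : ℕ)) + ∑ i : Fin (Multiset.card lam), (i : ℕ)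
      = ∑ i, jtL lam i + ∑ i : Fin (Multiset.card lam), (i : ℕ) := by
    rw [← Finset.sum_add_distrib]
    have : ∑ i : Fin (Multiset.card lam), (i : ℕ) = ∑ i : Fin (Multiset.card lam), ((σ i : Fin _) : ℕ) :=
      (Equiv.sum_comp σ (fun i => (i : ℕ))).symm
    conv_rhs => rw [this, ← Finset.sum_add_distrib]
    refine Finset.sum_congr rfl fun i _ => ?_
    have := h i
    omega
  exact Nat.add_right_cancel h2

def jtSq (s : Multiset ℕ) : ℕ := (s.map (fun x => x ^ 2)).sum

theorem jt_sq (lam : Multiset ℕ) (σ : Equiv.Perm (Fin (Multiset.card lam))) (h : jtV lam σ)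
    (hσ : σ ≠ 1) : jtSq lam < jtSq (jtA lam σ) := by
  unfold jtSq
  rw [jtA, jt_filter_sum _ _ (by simp), Multiset.map_map]
  conv_lhs => rw [← jtL_map lam, Multiset.map_map]
  change ∑ i, (jtL lam i) ^ 2 < ∑ i, (jtL lam i + (σ i : ℕ) - (i : ℕ)) ^ 2
  zify
  have e : ∀ i, ((jtL lam i + (σ i : ℕ) - (i : ℕ) : ℕ) : ℤ) = (jtL lam i : ℤ) + ((σ i : ℕ) : ℤ) - ((i : ℕ) : ℤ) := by
    intro i
    rw [Nat.cast_sub (h i)]; push_cast; ring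
  simp_rw [e]
  have hre : ∑ i, (jtL lam i : ℤ) * ((i : ℕ) : ℤ) ≤ ∑ i, (jtL lam i : ℤ) * ((σ i : ℕ) : ℤ) := by
    have hav : Antivary (fun i => (jtL lam i : ℤ)) (fun i : Fin (Multiset.card lam) => ((i : ℕ) : ℤ)) := by
      intro i j hij
      have hij' : i < j := by
        simp only [Nat.cast_lt] at hij
        exact hij
      have := jtL_anti lam hij'.le
      simp only
      exact_mod_cast this
    exact hav.sum_mul_le_sum_mul_comp_perm (σ := σ)
  have hpos : 0 < ∑ i, (((σ i : ℕ) : ℤ) - ((i : ℕ) : ℤ)) ^ 2 := by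
    apply Finset.sum_pos'
    · intro i _; positivity
    · by_contra hc
      push Not at hc
      apply hσ
      ext i
      have := hc i (Finset.mem_univ i)
      have h2 : ((σ i : ℕ) : ℤ) - ((i : ℕ) : ℤ) = 0 := by
        by_contra h3
        have : 0 < (((σ i : ℕ) : ℤ) - ((i : ℕ) : ℤ)) ^ 2 := by positivity
        linarith
      rw [Equiv.Perm.one_apply]
      omega
  have key : ∑ i, ((jtL lam i : ℤ) + ((σ i : ℕ) : ℤ) - ((i : ℕ) : ℤ)) ^ 2 =
      ∑ i, (jtL lam i : ℤ) ^ 2 + 2 * (∑ i, (jtL lam i : ℤ) * ((σ i : ℕ) : ℤ) - ∑ i, (jtL lam i : ℤ) * ((i : ℕ) : ℤ))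
      + ∑ i, (((σ i : ℕ) : ℤ) - ((i : ℕ) : ℤ)) ^ 2 := by
    rw [← Finset.sum_sub_distrib, Finset.mul_sum, ← Finset.sum_add_distrib, ← Finset.sum_add_distrib]
    refine Finset.sum_congr rfl fun i _ => ?_
    ring
  rw [key]
  linarith

theorem jt_one (lam : Multiset ℕ) (hl : ∀ i ∈ lam, 0 < i) : jtV lam 1 ∧ jtA lam 1 = lam := by
  constructor
  · intro i; simp
  · unfold jtA
    simp only [Equiv.Perm.one_apply, Nat.add_sub_cancel]
    rw [show (Multiset.map (fun i => jtL lam i) Finset.univ.val) = lam from jtL_map lam]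
    rw [Multiset.filter_eq_self]
    intro a ha
    have := hl a ha
    omega

def jtM (w : ℕ) : Matrix (Nat.Partition w) (Nat.Partition w) ℤ :=
  Matrix.of fun lam mu => ∑ σ : Equiv.Perm (Fin (Multiset.card lam.parts)),
    (Equiv.Perm.sign σ : ℤ) * (if jtV lam.parts σ ∧ jtA lam.parts σ = mu.parts then 1 else 0)

theorem jt_sval {w : ℕ} (lam : Nat.Partition w) (nu : Multiset ℕ) :
    sval lam.parts nu = ∑ mu : Nat.Partition w, (jtM w lam mu : ℚ) * (Mcount mu.parts nu : ℚ) := by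
  rw [sval_eq]
  simp only [jtM, Matrix.of_apply, Int.cast_sum, Int.cast_mul, Finset.sum_mul]
  rw [Finset.sum_comm]
  refine Finset.sum_congr rfl fun σ _ => ?_
  simp only [mul_assoc]
  rw [← Finset.mul_sum]
  congr 1
  by_cases hv : jtV lam.parts σ
  · rw [if_pos hv]
    let m0 : Nat.Partition w := ⟨jtA lam.parts σ, by
      intro i hi
      have := (Multiset.mem_filter.1 hi).2
      omega, by rw [jt_sum _ _ hv, lam.parts_sum]⟩
    rw [Finset.sum_eq_single m0]
    · simp [hv, m0]
    · intro mu _ hmu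
      have : ¬ (jtV lam.parts σ ∧ jtA lam.parts σ = mu.parts) := by
        rintro ⟨_, h⟩
        exact hmu (Nat.Partition.ext h.symm)
      rw [if_neg this]; simp
    · simp
  · simp [hv]

theorem jt_det (w : ℕ) : (jtM w).det = 1 := by
  rw [la_tri (jtM w) (fun mu => jtSq mu.parts)]
  · refine Finset.prod_eq_one fun lam _ => ?_
    simp only [jtM, Matrix.of_apply]
    rw [Finset.sum_eq_single 1]
    · simp [jt_one lam.parts (fun i hi => lam.parts_pos hi)]
    · intro σ _ hσ
      rw [if_neg, mul_zero]
      rintro ⟨h1, h2⟩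
      have := jt_sq _ σ h1 hσ
      rw [h2] at this
      omega
    · simp
  · intro lam mu hne h
    simp only [jtM, Matrix.of_apply] at h
    obtain ⟨σ, _, hσ⟩ := Finset.exists_ne_zero_of_sum_ne_zero h
    have hc : jtV lam.parts σ ∧ jtA lam.parts σ = mu.parts := by
      by_contra hc
      rw [if_neg hc, mul_zero] at hσ
      exact hσ rfl
    have h1 : σ ≠ 1 := by
      rintro rfl
      apply hne
      ext1
      rw [← hc.2, (jt_one lam.parts (fun i hi => lam.parts_pos hi)).2]
    have := jt_sq _ σ hc.1 h1
    rwa [hc.2] at this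



/-- ring of symmetric functions over the rationals, `X n` is the `n`-th power sum -/
abbrev PA := MvPolynomial ℕ ℚ

def hA : ℕ → PA
  | 0 => 1
  | n + 1 => MvPolynomial.C ((n + 1 : ℚ)⁻¹) *
      ∑ i : Fin (n + 1), MvPolynomial.X ((i : ℕ) + 1) * hA (n - i)

theorem hA_zero : hA 0 = 1 := by rw [hA]

theorem hA_succ (n : ℕ) : MvPolynomial.C (n + 1 : ℚ) * hA (n + 1) =
    ∑ i ∈ Finset.range (n + 1), MvPolynomial.X (i + 1) * hA (n - i) := by
  rw [hA, ← mul_assoc, ← MvPolynomial.C_mul, mul_inv_cancel₀ (by positivity), MvPolynomial.C_1,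
    one_mul]
  exact (Finset.sum_range (fun i => MvPolynomial.X (i + 1) * hA (n - i))).symm

def phi (l : ℚ) : PA →ₐ[ℚ] PA :=
  MvPolynomial.aeval (fun n => MvPolynomial.C l * MvPolynomial.X n)

def psi (p : ℕ) : PA →ₐ[ℚ] PA := MvPolynomial.aeval (fun n => MvPolynomial.X (p * n))

def evk (k : ℕ) : PA →ₐ[ℚ] MvPolynomial (Fin k) ℚ :=
  MvPolynomial.aeval (fun n => ∑ i, MvPolynomial.X i ^ n)

abbrev zq (k : ℕ) : MvPolynomial (Fin k) ℤ →+* MvPolynomial (Fin k) ℚ :=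
  MvPolynomial.map (Int.castRingHom ℚ)

def Rm (m : ℤ) (f : PA) : Prop :=
  ∀ k, ∃ g : MvPolynomial (Fin k) ℤ, evk k f = zq k (MvPolynomial.C m * g)

theorem phi_X (l : ℚ) (n : ℕ) : phi l (MvPolynomial.X n) = MvPolynomial.C l * MvPolynomial.X n := by
  simp [phi]

theorem psi_X (p n : ℕ) : psi p (MvPolynomial.X n) = MvPolynomial.X (p * n) := by
  simp [psi]

theorem evk_X (k n : ℕ) : evk k (MvPolynomial.X n) = ∑ i, MvPolynomial.X i ^ n := by
  simp [evk]

theorem evk_C (k : ℕ) (c : ℚ) : evk k (MvPolynomial.C c) = MvPolynomial.C c := by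
  simp [evk]

theorem phi_C (l : ℚ) (c : ℚ) : phi l (MvPolynomial.C c) = MvPolynomial.C c := by
  simp [phi]

theorem psi_C (p : ℕ) (c : ℚ) : psi p (MvPolynomial.C c) = MvPolynomial.C c := by
  simp [psi]

theorem psi_phi (p : ℕ) (l : ℚ) (f : PA) : psi p (phi l f) = phi l (psi p f) := by
  have : (psi p).comp (phi l) = (phi l).comp (psi p) := by
    apply MvPolynomial.algHom_ext
    intro n
    simp [phi_X, psi_X, psi_C]
  exact DFunLike.congr_fun this f

theorem evk_psi (p k : ℕ) (f : PA) :
    evk k (psi p f) = MvPolynomial.expand p (evk k f) := by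
  have : (evk k).comp (psi p) = (MvPolynomial.expand p).comp (evk k) := by
    apply MvPolynomial.algHom_ext
    intro n
    simp [evk_X, psi_X, pow_mul]
  exact DFunLike.congr_fun this f

theorem Rm_add {m : ℤ} {f g : PA} (hf : Rm m f) (hg : Rm m g) : Rm m (f + g) := by
  intro k
  obtain ⟨a, ha⟩ := hf k
  obtain ⟨b, hb⟩ := hg k
  exact ⟨a + b, by rw [map_add, ha, hb, ← map_add, mul_add]⟩

theorem Rm_mul {m n : ℤ} {f g : PA} (hf : Rm m f) (hg : Rm n g) : Rm (m * n) (f * g) := by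
  intro k
  obtain ⟨a, ha⟩ := hf k
  obtain ⟨b, hb⟩ := hg k
  exact ⟨a * b, by rw [map_mul, ha, hb, ← map_mul, MvPolynomial.C_mul]; congr 1; ring⟩

theorem Rm_mul' {m n q : ℤ} {f g : PA} (hf : Rm m f) (hg : Rm n g) (h : m * n = q) :
    Rm q (f * g) := h ▸ Rm_mul hf hg

theorem Rm_C (m : ℤ) : Rm m (MvPolynomial.C (m : ℚ)) := by
  intro k
  exact ⟨1, by simp [evk_C]⟩

theorem Rm_one : Rm 1 1 := by
  simpa using Rm_C 1

theorem Rm_neg {m : ℤ} {f : PA} (hf : Rm m f) : Rm m (-f) := by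
  intro k
  obtain ⟨a, ha⟩ := hf k
  exact ⟨-a, by rw [map_neg, ha, ← map_neg, mul_neg]⟩

theorem Rm_sub {m : ℤ} {f g : PA} (hf : Rm m f) (hg : Rm m g) : Rm m (f - g) := by
  rw [sub_eq_add_neg]
  exact Rm_add hf (Rm_neg hg)

theorem Rm_pow {m : ℤ} {f : PA} (hf : Rm m f) (n : ℕ) : Rm (m ^ n) (f ^ n) := by
  induction n with
  | zero => simpa using Rm_one
  | succ n ih => rw [pow_succ, pow_succ]; exact Rm_mul ih hf

theorem Rm_pow1 {f : PA} (hf : Rm 1 f) (n : ℕ) : Rm 1 (f ^ n) := by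
  simpa using Rm_pow hf n

theorem Rm_dvd {m n : ℤ} {f : PA} (hf : Rm m f) (h : n ∣ m) : Rm n f := by
  obtain ⟨c, rfl⟩ := h
  intro k
  obtain ⟨a, ha⟩ := hf k
  exact ⟨MvPolynomial.C c * a, by rw [ha, MvPolynomial.C_mul, mul_assoc]⟩

theorem Rm_congr_mul {m : ℤ} {a b c d : PA} (hab : Rm m (a - b)) (hcd : Rm m (c - d))
    (hc : Rm 1 c) (hb : Rm 1 b) : Rm m (a * c - b * d) := by
  have : a * c - b * d = (a - b) * c + b * (c - d) := by ring
  rw [this]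
  exact Rm_add (Rm_mul' hab hc (by ring)) (Rm_mul' hb hcd (by ring))

theorem Rm_congr_pow {m : ℤ} {a b : PA} (hab : Rm m (a - b)) (ha : Rm 1 a) (hb : Rm 1 b) (n : ℕ) :
    Rm m (a ^ n - b ^ n) := by
  induction n with
  | zero =>
    simp only [pow_zero, sub_self]
    intro k
    exact ⟨0, by simp⟩
  | succ n ih => 
    rw [pow_succ, pow_succ]
    exact Rm_congr_mul ih hab ha (Rm_pow1 hb n)

theorem Rm_div {m : ℤ} (hm : m ≠ 0) {f : PA} (hf : Rm m f) :
    ∃ V, f = MvPolynomial.C (m : ℚ) * V ∧ Rm 1 V := by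
  have hm' : (m : ℚ) ≠ 0 := by exact_mod_cast hm
  refine ⟨MvPolynomial.C ((m : ℚ)⁻¹) * f, ?_, ?_⟩
  · rw [← mul_assoc, ← MvPolynomial.C_mul, mul_inv_cancel₀ hm', MvPolynomial.C_1, one_mul]
  · intro k
    obtain ⟨a, ha⟩ := hf k
    refine ⟨a, ?_⟩
    rw [map_mul, ha, evk_C, map_mul, ← mul_assoc]
    rw [MvPolynomial.map_C, eq_intCast, ← MvPolynomial.C_mul, inv_mul_cancel₀ hm']
    simp

theorem Rm_frob {p : ℕ} (hp : p.Prime) {f : PA} (hf : Rm 1 f) : Rm p (f ^ p - psi p f) := by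
  intro k
  obtain ⟨a, ha⟩ := hf k
  rw [MvPolynomial.C_1, one_mul] at ha
  haveI : Fact p.Prime := ⟨hp⟩
  have hd : (MvPolynomial.C (p : ℤ)) ∣ a ^ p - MvPolynomial.expand p a := by
    rw [MvPolynomial.C_dvd_iff_zmod, map_sub, map_pow, MvPolynomial.map_expand,
      MvPolynomial.expand_zmod, sub_self]
  obtain ⟨g, hg⟩ := hd
  refine ⟨g, ?_⟩
  rw [← hg, map_sub, map_pow, evk_psi, ha, map_sub, map_pow, MvPolynomial.map_expand]

def Hom (d : ℕ) : Submodule ℚ PA :=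
  Submodule.span ℚ (Set.range fun nu : Nat.Partition d => (nu.parts.map MvPolynomial.X).prod)

theorem Hom_mon {s : Multiset ℕ} (hs : ∀ i ∈ s, 0 < i) :
    (s.map MvPolynomial.X).prod ∈ Hom s.sum :=
  Submodule.subset_span ⟨⟨s, fun {i} hi => hs i hi, rfl⟩, rfl⟩

theorem Hom_mon' {s : Multiset ℕ} (hs : ∀ i ∈ s, 0 < i) {d : ℕ} (hd : s.sum = d) :
    (s.map MvPolynomial.X).prod ∈ Hom d := hd ▸ Hom_mon hs

theorem Hom_one : (1 : PA) ∈ Hom 0 := by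
  have := Hom_mon (s := 0) (by simp)
  simpa using this

theorem Hom_X (n : ℕ) (hn : 0 < n) : (MvPolynomial.X n : PA) ∈ Hom n := by
  have := Hom_mon (s := {n}) (by simpa using hn)
  simpa using this

theorem Hom_mul {a b : ℕ} {f g : PA} (hf : f ∈ Hom a) (hg : g ∈ Hom b) : f * g ∈ Hom (a + b) := by
  have h := Submodule.mul_mem_mul hf hg
  rw [Hom, Hom, Submodule.span_mul_span] at h
  revert h
  apply Submodule.span_le.2
  rintro _ ⟨_, ⟨x, rfl⟩, _, ⟨y, rfl⟩, rfl⟩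
  simp only
  rw [← Multiset.prod_add, ← Multiset.map_add]
  apply Hom_mon'
  · intro i hi
    rcases Multiset.mem_add.1 hi with h | h
    · exact x.parts_pos h
    · exact y.parts_pos h
  · simp [x.parts_sum, y.parts_sum]

theorem Hom_mul' {a b c : ℕ} {f g : PA} (hf : f ∈ Hom a) (hg : g ∈ Hom b) (h : a + b = c) :
    f * g ∈ Hom c := h ▸ Hom_mul hf hg

theorem Hom_pow {a : ℕ} {f : PA} (hf : f ∈ Hom a) (n : ℕ) : f ^ n ∈ Hom (a * n) := by
  induction n with
  | zero => simpa using Hom_one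
  | succ n ih => rw [pow_succ]; exact Hom_mul' ih hf (by ring)

theorem Hom_C {a : ℕ} {f : PA} (hf : f ∈ Hom a) (c : ℚ) : MvPolynomial.C c * f ∈ Hom a := by
  rw [← MvPolynomial.smul_eq_C_mul]
  exact Submodule.smul_mem _ _ hf

theorem Hom_psi {p : ℕ} (hp : 0 < p) {a : ℕ} {f : PA} (hf : f ∈ Hom a) : psi p f ∈ Hom (a * p) := by
  have : Hom a ≤ (Hom (a * p)).comap (psi p).toLinearMap := by
    apply Submodule.span_le.2
    rintro _ ⟨x, rfl⟩
    simp only [SetLike.mem_coe, Submodule.mem_comap, AlgHom.toLinearMap_apply]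
    have e : psi p ((x.parts.map MvPolynomial.X).prod)
        = ((x.parts.map (fun n => p * n)).map MvPolynomial.X).prod := by
      rw [map_multiset_prod, Multiset.map_map, Multiset.map_map]
      congr 1
      apply Multiset.map_congr rfl
      intro i _
      simp [psi_X]
    rw [e]
    apply Hom_mon'
    · intro i hi
      obtain ⟨j, hj, rfl⟩ := Multiset.mem_map.1 hi
      exact Nat.mul_pos hp (x.parts_pos hj)
    · rw [Multiset.sum_map_mul_left, Multiset.map_id', x.parts_sum, mul_comm]
  exact this hf

theorem Hom_hA (n : ℕ) : hA n ∈ Hom n := by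
  induction n using Nat.strong_induction_on with
  | _ n ih =>
    cases n with
    | zero => rw [hA_zero]; exact Hom_one
    | succ n =>
      rw [hA]
      apply Hom_C
      apply Submodule.sum_mem
      intro i _
      exact Hom_mul' (Hom_X _ (by omega)) (ih (n - i) (by omega)) (by omega)

theorem exists_W {p : ℕ} (hp : p.Prime) (l : ℚ) (m : ℕ) : ∀ (f : PA) (e d : ℕ), 1 ≤ e → f ∈ Hom d →
    Rm 1 f → Rm ((p : ℤ) ^ e) (phi l f) →
    ∃ W, W ∈ Hom (d * m) ∧ Rm 1 W ∧ Rm p (W - f ^ m) ∧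
      Rm ((p : ℤ) ^ (e * m + padicValNat p m.factorial)) (phi l W) := by
  haveI : Fact p.Prime := ⟨hp⟩
  induction m using Nat.strong_induction_on with
  | _ m ih =>
    intro f e d he hd h1 hphi
    rcases Nat.eq_zero_or_pos m with rfl | hm
    · refine ⟨1, by simpa using Hom_one, Rm_one, ?_, by simpa using Rm_one⟩
      intro k
      exact ⟨0, by simp⟩
    set a := m / p with ha
    set b := m % p with hb
    have hab : p * a + b = m := Nat.div_add_mod m p
    have hlt : a < m := Nat.div_lt_self hm hp.one_lt
    obtain ⟨f', hf'⟩ : ∃ f', f' = f ^ p - MvPolynomial.C ((p : ℚ) ^ ((p - 1) * e)) * psi p f := ⟨_, rfl⟩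
    have hp1 : 1 ≤ p - 1 := by have := hp.two_le; omega
    have hpe : (p - 1) * e + e = p * e := by
      have : p = (p - 1) + 1 := by omega
      conv_rhs => rw [this]
      ring
    have hpsi : Rm 1 (psi p f) := by
      have := Rm_sub (Rm_pow1 h1 p) (Rm_dvd (Rm_frob hp h1) (one_dvd _))
      simpa using this
    have hpC : Rm ((p : ℤ) ^ ((p - 1) * e)) (MvPolynomial.C ((p : ℚ) ^ ((p - 1) * e)) * psi p f) := by
      have := Rm_mul (Rm_C ((p : ℤ) ^ ((p - 1) * e))) hpsi
      simpa using this
    have hne : (p - 1) * e ≠ 0 := Nat.mul_ne_zero (by omega) (by omega)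
    have hf'1 : Rm 1 f' := by
      rw [hf']
      exact Rm_sub (Rm_pow1 h1 p) (Rm_dvd hpC (one_dvd _))
    have hf'p : Rm p (f' - f ^ p) := by
      rw [hf', show f ^ p - MvPolynomial.C ((p : ℚ) ^ ((p - 1) * e)) * psi p f - f ^ p =
        -(MvPolynomial.C ((p : ℚ) ^ ((p - 1) * e)) * psi p f) by ring]
      exact Rm_neg (Rm_dvd hpC (dvd_pow_self _ hne))
    have hf'H : f' ∈ Hom (d * p) := by
      rw [hf']
      exact Submodule.sub_mem _ (Hom_pow hd p) (Hom_C (Hom_psi hp.pos hd) _)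
    have hf'phi : Rm ((p : ℤ) ^ (p * e + 1)) (phi l f') := by
      have hp0 : (p : ℤ) ^ e ≠ 0 := pow_ne_zero _ (by exact_mod_cast hp.ne_zero)
      obtain ⟨V, hV, hV1⟩ := Rm_div hp0 hphi
      have e1 : phi l f' = MvPolynomial.C ((((p : ℤ) ^ (p * e) : ℤ)) : ℚ) * (V ^ p - psi p V) := by
        rw [hf', map_sub, map_pow, map_mul, phi_C, ← psi_phi, hV, map_mul, psi_C, mul_pow,
          ← mul_assoc, ← MvPolynomial.C_mul, ← MvPolynomial.C_pow]
        push_cast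
        rw [← pow_add, hpe, ← pow_mul, mul_comm e p]
        ring
      rw [e1]
      exact Rm_mul' (Rm_C _) (Rm_frob hp hV1) (by ring)
    obtain ⟨W, hW1, hW2, hW3, hW4⟩ := ih a hlt f' (p * e + 1) (d * p) (by omega) hf'H hf'1 hf'phi
    refine ⟨W * f ^ b, ?_, ?_, ?_, ?_⟩
    · exact Hom_mul' hW1 (Hom_pow hd b) (by rw [← hab]; ring)
    · exact Rm_mul' hW2 (Rm_pow1 h1 b) (by ring)
    · have h3 : Rm p (W - (f ^ p) ^ a) := by
        have := Rm_add hW3 (Rm_congr_pow hf'p hf'1 (Rm_pow1 h1 p) a)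
        simpa using this
      have h4 := Rm_mul' h3 (Rm_pow1 h1 b) (mul_one _)
      have : W * f ^ b - f ^ m = (W - (f ^ p) ^ a) * f ^ b := by
        rw [← hab]; ring
      rw [this]
      exact h4
    · rw [map_mul, map_pow]
      refine Rm_mul' hW4 (Rm_pow hphi b) ?_
      have hv : padicValNat p m.factorial = padicValNat p a.factorial + a := by
        rw [← hab, padicValNat_factorial_mul_add _ (Nat.mod_lt _ hp.pos), padicValNat_factorial_mul]
      rw [hv, ← pow_mul, ← pow_add, ← hab]
      congr 1
      ring



def gF (k : ℕ) : PowerSeries (MvPolynomial (Fin k) ℤ) :=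
  ∏ i : Fin k, PowerSeries.mk (fun n => (MvPolynomial.X i : MvPolynomial (Fin k) ℤ) ^ n)

theorem ps_geom {R : Type*} [CommRing R] (x : R) :
    PowerSeries.derivative R (PowerSeries.mk (fun n => x ^ n)) =
      PowerSeries.mk (fun n => x ^ (n + 1)) * PowerSeries.mk (fun n => x ^ n) := by
  ext n
  rw [PowerSeries.coeff_derivative, PowerSeries.coeff_mul]
  simp only [PowerSeries.coeff_mk]
  have : ∀ q ∈ Finset.HasAntidiagonal.antidiagonal n, x ^ (q.1 + 1) * x ^ q.2 = x ^ (n + 1) := by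
    intro q hq
    rw [← pow_add, ← Finset.HasAntidiagonal.mem_antidiagonal.1 hq]
    congr 1
    ring
  rw [Finset.sum_congr rfl this, Finset.sum_const, Finset.Nat.card_antidiagonal, nsmul_eq_mul]
  push_cast
  ring

theorem ps_prod {R ι : Type*} [CommRing R] (s : Finset ι) (F P : ι → PowerSeries R)
    (h : ∀ i, PowerSeries.derivative R (F i) = P i * F i) :
    PowerSeries.derivative R (∏ i ∈ s, F i) = (∑ i ∈ s, P i) * ∏ i ∈ s, F i := by
  induction s using Finset.induction_on with
  | empty => simp
  | insert a s ha ih =>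
    rw [Finset.prod_insert ha, Finset.sum_insert ha, Derivation.leibniz, ih, h]
    simp only [smul_eq_mul]
    ring

theorem gF_coeff (k l n : ℕ) :
    ((n + 1 : ℕ) : MvPolynomial (Fin k) ℤ) * PowerSeries.coeff (n + 1) (gF k ^ l) =
      (l : MvPolynomial (Fin k) ℤ) * ∑ i ∈ Finset.range (n + 1),
        (∑ j : Fin k, MvPolynomial.X j ^ (i + 1)) * PowerSeries.coeff (n - i) (gF k ^ l) := by
  have h1 := ps_prod Finset.univ (fun i : Fin k => PowerSeries.mk (fun n => (MvPolynomial.X i : MvPolynomial (Fin k) ℤ) ^ n))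
    _ (fun i => ps_geom _)
  have h2 := ps_prod (Finset.range l) (fun _ => gF k) _ (fun _ => h1)
  simp only [Finset.prod_const, Finset.card_range, Finset.sum_const] at h2
  have h3 := congrArg (PowerSeries.coeff n) h2
  rw [PowerSeries.coeff_derivative, smul_mul_assoc, map_nsmul, nsmul_eq_mul, PowerSeries.coeff_mul,
    Finset.Nat.sum_antidiagonal_eq_sum_range_succ_mk] at h3
  push_cast
  rw [mul_comm, h3]
  congr 1
  refine Finset.sum_congr rfl fun i _ => ?_
  congr 1
  simp only [map_sum, PowerSeries.coeff_mk]

theorem evk_phi (k l n : ℕ) :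
    evk k (phi l (hA n)) = zq k (PowerSeries.coeff n (gF k ^ l)) := by
  induction n using Nat.strong_induction_on with
  | _ n ih =>
    cases n with
    | zero =>
      rw [hA_zero, map_one, map_one, PowerSeries.coeff_zero_eq_constantCoeff_apply, map_pow, gF, map_prod]
      simp [← PowerSeries.coeff_zero_eq_constantCoeff_apply]
    | succ n =>
      have h1 := congrArg (fun f => evk k (phi l f)) (hA_succ n)
      have h2 := congrArg (zq k) (gF_coeff k l n)
      simp only [map_mul, map_sum, phi_C, evk_C, phi_X, evk_X, map_natCast, map_pow, MvPolynomial.map_X] at h1 h2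
      have h3 : (MvPolynomial.C ((n : ℚ) + 1) : MvPolynomial (Fin k) ℚ) ≠ 0 := by
        rw [Ne, MvPolynomial.C_eq_zero]
        positivity
      apply mul_left_cancel₀ h3
      rw [h1]
      have h4 : (MvPolynomial.C ((n : ℚ) + 1) : MvPolynomial (Fin k) ℚ) = ((n + 1 : ℕ) : MvPolynomial (Fin k) ℚ) := by
        simp
      rw [h4, h2, Finset.mul_sum]
      refine Finset.sum_congr rfl fun i hi => ?_
      rw [ih (n - i) (by omega)]
      simp [mul_assoc]

theorem Rm_phi_one (l n : ℕ) : Rm 1 (phi l (hA n)) := by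
  intro k
  exact ⟨_, by rw [evk_phi, MvPolynomial.C_1, one_mul]⟩

theorem phi_one (f : PA) : phi 1 f = f := by
  have : phi 1 = AlgHom.id ℚ PA := by
    apply MvPolynomial.algHom_ext
    intro n
    simp [phi_X]
  rw [this]; rfl

theorem Rm_h (n : ℕ) : Rm 1 (hA n) := by
  have := Rm_phi_one 1 n
  rwa [Nat.cast_one, phi_one] at this

theorem Rm_phi {p : ℕ} (hp : p.Prime) (r n : ℕ) (hn : 0 < n) (hv : padicValNat p n < r) :
    Rm ((p : ℤ) ^ (r - padicValNat p n)) (phi ((p : ℚ) ^ r) (hA n)) := by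
  have : Fact p.Prime := ⟨hp⟩
  intro k
  have hd : MvPolynomial.C ((p : ℤ) ^ (r - padicValNat p n)) ∣ PowerSeries.coeff n (gF k ^ (p ^ r)) := by
    rw [MvPolynomial.C_dvd_iff_dvd_coeff]
    intro m
    obtain ⟨n, rfl⟩ : ∃ n', n = n' + 1 := ⟨n - 1, by omega⟩
    have h1 := congrArg (MvPolynomial.coeff m) (gF_coeff k (p ^ r) n)
    rw [← nsmul_eq_mul, ← nsmul_eq_mul, MvPolynomial.coeff_smul, MvPolynomial.coeff_smul,
      nsmul_eq_mul, nsmul_eq_mul] at h1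
    generalize MvPolynomial.coeff m (PowerSeries.coeff (n + 1) (gF k ^ (p ^ r))) = x at h1 ⊢
    generalize MvPolynomial.coeff m (∑ i ∈ Finset.range (n + 1),
        (∑ j : Fin k, MvPolynomial.X j ^ (i + 1)) * PowerSeries.coeff (n - i) (gF k ^ (p ^ r))) = y at h1
    obtain ⟨n', hn'⟩ := pow_padicValNat_dvd (p := p) (n := n + 1)
    have hcop : ¬ p ∣ n' := by
      intro hc
      apply pow_succ_padicValNat_not_dvd (p := p) (n := n + 1) (by omega)
      conv_rhs => rw [hn']
      rw [pow_succ]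
      exact mul_dvd_mul_left _ hc
    have h2 : (p : ℤ) ^ padicValNat p (n + 1) * (p : ℤ) ^ (r - padicValNat p (n + 1)) ∣
        (p : ℤ) ^ padicValNat p (n + 1) * (n' * x) := by
      refine ⟨y, ?_⟩
      rw [← pow_add, Nat.add_sub_cancel' hv.le, ← mul_assoc]
      have e1 : (p : ℤ) ^ padicValNat p (n + 1) * n' = ((n + 1 : ℕ) : ℤ) := by
        exact_mod_cast hn'.symm
      rw [e1, h1]
      push_cast
      ring
    have h3 := (mul_dvd_mul_iff_left (pow_ne_zero _ (by exact_mod_cast hp.ne_zero))).1 h2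
    refine IsCoprime.dvd_of_dvd_mul_left ?_ h3
    apply IsCoprime.pow_left
    rw [Nat.isCoprime_iff_coprime]
    exact (Nat.Prime.coprime_iff_not_dvd hp).2 hcop
  obtain ⟨g, hg⟩ := hd
  refine ⟨g, ?_⟩
  rw [← hg, ← evk_phi]
  push_cast
  rfl

theorem exists_Wh {p : ℕ} (hp : p.Prime) (r n : ℕ) (hn : 0 < n) (m : ℕ) :
    ∃ W, W ∈ Hom (n * m) ∧ Rm 1 W ∧ Rm p (W - hA n ^ m) ∧
      Rm ((p : ℤ) ^ (if padicValNat p n < r then (r - padicValNat p n) * m + padicValNat p m.factorial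
        else 0)) (phi ((p : ℚ) ^ r) W) := by
  by_cases hv : padicValNat p n < r
  · rw [if_pos hv]
    exact exists_W hp _ m (hA n) _ n (by omega) (Hom_hA n) (Rm_h n) (Rm_phi hp r n hn hv)
  · rw [if_neg hv, pow_zero]
    refine ⟨hA n ^ m, Hom_pow (Hom_hA n) m, Rm_pow1 (Rm_h n) m, ?_, ?_⟩
    · intro k
      exact ⟨0, by simp⟩
    · rw [map_pow]
      have := Rm_phi_one (p ^ r) n
      push_cast at this
      exact Rm_pow1 this m

theorem exists_us {p : ℕ} (hp : p.Prime) (r : ℕ) (c : ℕ → ℕ) (s : Finset ℕ) (hs : ∀ n ∈ s, 0 < n) :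
    ∃ u, u ∈ Hom (∑ n ∈ s, n * c n) ∧ Rm 1 u ∧ Rm p (u - ∏ n ∈ s, hA n ^ c n) ∧
      Rm ((p : ℤ) ^ (∑ n ∈ s, if padicValNat p n < r then
        (r - padicValNat p n) * c n + padicValNat p (c n).factorial else 0))
        (phi ((p : ℚ) ^ r) u) := by
  induction s using Finset.induction_on with
  | empty =>
    refine ⟨1, by simpa using Hom_one, Rm_one, ?_, by simpa using Rm_one⟩
    intro k
    exact ⟨0, by simp⟩
  | insert a s ha ih =>
    obtain ⟨u, h1, h2, h3, h4⟩ := ih (fun n hn => hs n (Finset.mem_insert_of_mem hn))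
    obtain ⟨W, g1, g2, g3, g4⟩ := exists_Wh hp r a (hs a (Finset.mem_insert_self _ _)) (c a)
    refine ⟨W * u, ?_, ?_, ?_, ?_⟩
    · rw [Finset.sum_insert ha]; exact Hom_mul g1 h1
    · exact Rm_mul' g2 h2 (by ring)
    · rw [Finset.prod_insert ha]
      exact Rm_congr_mul g3 h3 h2 (Rm_pow1 (Rm_h a) _)
    · rw [Finset.sum_insert ha, pow_add, map_mul]
      exact Rm_mul g4 h4

theorem exists_u {p : ℕ} (hp : p.Prime) (r : ℕ) {w : ℕ} (lam : Nat.Partition w) :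
    ∃ u, u ∈ Hom w ∧ Rm p (u - (lam.parts.map hA).prod) ∧
      Rm ((p : ℤ) ^ cpr p r lam.parts) (phi ((p : ℚ) ^ r) u) := by
  obtain ⟨u, h1, h2, h3, h4⟩ := exists_us hp r (fun n => lam.parts.count n) lam.parts.toFinset
    (fun n hn => lam.parts_pos (Multiset.mem_toFinset.1 hn))
  refine ⟨u, ?_, ?_, ?_⟩
  · have : ∑ n ∈ lam.parts.toFinset, n * lam.parts.count n = w := by
      conv_rhs => rw [← lam.parts_sum]
      rw [Finset.sum_multiset_count]
      refine Finset.sum_congr rfl fun n _ => by rw [smul_eq_mul, mul_comm]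
    rwa [this] at h1
  · rw [Finset.prod_multiset_map_count]
    exact h3
  · rw [cpr, Finset.sum_filter]
    exact h4



theorem zMult_sup (s : Multiset ℕ) (T : Finset ℕ) (h : s.toFinset ⊆ T) :
    zMult s = ∏ i ∈ T, i ^ s.count i * (s.count i).factorial := by
  unfold zMult
  apply Finset.prod_subset h
  intro i _ hi
  have : s.count i = 0 := by
    rw [Multiset.count_eq_zero]
    simpa using hi
  simp [this]

theorem zMult_cons (k : ℕ) (s : Multiset ℕ) :
    zMult (k ::ₘ s) = zMult s * (k * (s.count k + 1)) := by
  have hk : k ∈ insert k s.toFinset := Finset.mem_insert_self _ _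
  rw [zMult_sup s (insert k s.toFinset) (Finset.subset_insert _ _),
    zMult_sup (k ::ₘ s) (insert k s.toFinset) (by rw [Multiset.toFinset_cons]),
    ← Finset.mul_prod_erase _ _ hk, ← Finset.mul_prod_erase _ (fun i => i ^ s.count i * (s.count i).factorial) hk,
    Multiset.count_cons_self, Nat.factorial_succ, pow_succ]
  have : ∀ i ∈ (insert k s.toFinset).erase k, i ^ (k ::ₘ s).count i * ((k ::ₘ s).count i).factorial =
      i ^ s.count i * (s.count i).factorial := by
    intro i hi
    rw [Multiset.count_cons_of_ne (Finset.ne_of_mem_erase hi)]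
  rw [Finset.prod_congr rfl this]
  ring

theorem zMult_ne {s : Multiset ℕ} (hs : ∀ i ∈ s, 0 < i) : (zMult s : ℚ) ≠ 0 := by
  have : zMult s ≠ 0 := by
    unfold zMult
    rw [Finset.prod_ne_zero_iff]
    intro i hi
    have := hs i (Multiset.mem_toFinset.1 hi)
    positivity
  exact_mod_cast this

/-- the coefficient of `p_s` in `f` -/
def cf (f : PA) (s : Multiset ℕ) : ℚ := MvPolynomial.coeff (Multiset.toFinsupp s) f

def Dk (k : ℕ) (f : PA) : PA := MvPolynomial.C (k : ℚ) * MvPolynomial.pderiv k f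

theorem val_cons (f : PA) (k : ℕ) (s : Multiset ℕ) :
    (zMult (k ::ₘ s) : ℚ) * cf f (k ::ₘ s) = (zMult s : ℚ) * cf (Dk k f) s := by
  unfold cf Dk
  rw [MvPolynomial.coeff_C_mul, MvPolynomial.coeff_pderiv, zMult_cons]
  have : Multiset.toFinsupp (k ::ₘ s) = Multiset.toFinsupp s + Finsupp.single k 1 := by
    rw [← Multiset.singleton_add, map_add, Multiset.toFinsupp_singleton, add_comm]
  rw [this]
  simp only [Multiset.toFinsupp_apply]
  push_cast
  ring

theorem Dk_mul (k : ℕ) (f g : PA) : Dk k (f * g) = Dk k f * g + f * Dk k g := by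
  unfold Dk
  rw [Derivation.leibniz]
  simp only [smul_eq_mul]
  ring

theorem Dk_C (k : ℕ) (c : ℚ) (f : PA) :
    Dk k (MvPolynomial.C c * f) = MvPolynomial.C c * Dk k f := by
  unfold Dk
  rw [Derivation.leibniz]
  simp
  ring

theorem Dk_sum {ι : Type*} (k : ℕ) (s : Finset ι) (f : ι → PA) :
    Dk k (∑ i ∈ s, f i) = ∑ i ∈ s, Dk k (f i) := by
  unfold Dk
  rw [map_sum, Finset.mul_sum]

theorem Dk_X (k n : ℕ) : Dk k (MvPolynomial.X n) = if n = k then MvPolynomial.C (k : ℚ) else 0 := by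
  unfold Dk
  rw [MvPolynomial.pderiv_X]
  by_cases h : n = k
  · subst h; simp
  · simp [Pi.single_apply, h]

theorem Dk_hA (k : ℕ) (hk : 0 < k) (n : ℕ) : Dk k (hA n) = if k ≤ n then hA (n - k) else 0 := by
  induction n using Nat.strong_induction_on with
  | _ n ih =>
    cases n with
    | zero => 
      rw [hA_zero, if_neg (by omega)]
      simp [Dk]
    | succ n =>
      have h3 : (MvPolynomial.C ((n : ℚ) + 1) : PA) ≠ 0 := by
        rw [Ne, MvPolynomial.C_eq_zero]
        positivity
      apply mul_left_cancel₀ h3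
      rw [← Dk_C, hA_succ, Dk_sum]
      have e : ∀ i ∈ Finset.range (n + 1), Dk k (MvPolynomial.X (i + 1) * hA (n - i)) =
          (if i = k - 1 then MvPolynomial.C (k : ℚ) * hA (n - i) else 0) +
          (if k ≤ n - i then MvPolynomial.X (i + 1) * hA (n - i - k) else 0) := by
        intro i hi
        rw [Dk_mul, Dk_X, ih (n - i) (by omega)]
        congr 1
        · by_cases h : i = k - 1
          · rw [if_pos h, if_pos (by omega)]
          · rw [if_neg h, if_neg (by omega), zero_mul]
        · split_ifs <;> simp
      rw [Finset.sum_congr rfl e, Finset.sum_add_distrib, Finset.sum_ite_eq']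
      by_cases hkn : k ≤ n + 1
      · rw [if_pos (by rw [Finset.mem_range]; omega), if_pos hkn]
        have hk' : n - (k - 1) = n + 1 - k := by omega
        rw [hk']
        obtain ⟨m, hm⟩ : ∃ m, n + 1 - k = m := ⟨_, rfl⟩
        have hsum : ∑ i ∈ Finset.range (n + 1), (if k ≤ n - i then (MvPolynomial.X (i + 1) : PA) * hA (n - i - k) else 0)
            = MvPolynomial.C (m : ℚ) * hA m := by
          rw [← Finset.sum_filter]
          have hf : (Finset.range (n + 1)).filter (fun i => k ≤ n - i) = Finset.range m := by
            ext i
            simp only [Finset.mem_filter, Finset.mem_range]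
            omega
          rw [hf]
          cases m with
          | zero => simp
          | succ m =>
            push_cast
            rw [hA_succ]
            refine Finset.sum_congr rfl fun i hi => ?_
            rw [Finset.mem_range] at hi
            congr 2
            omega
        rw [hsum, hm, ← add_mul, ← MvPolynomial.C_add]
        congr 2
        have : k + m = n + 1 := by omega
        exact_mod_cast this
      · rw [if_neg (by rw [Finset.mem_range]; omega), if_neg hkn, zero_add, mul_zero]
        apply Finset.sum_eq_zero
        intro i _
        rw [if_neg (by omega)]

theorem Dk_prod {ι : Type*} [DecidableEq ι] (k : ℕ) (s : Finset ι) (f : ι → PA) :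
    Dk k (∏ i ∈ s, f i) = ∑ i ∈ s, (∏ j ∈ s.erase i, f j) * Dk k (f i) := by
  induction s using Finset.induction_on with
  | empty => simp [Dk]
  | insert a s ha ih =>
    rw [Finset.prod_insert ha, Dk_mul, ih, Finset.sum_insert ha, Finset.erase_insert ha, mul_comm,
      Finset.mul_sum]
    congr 1
    refine Finset.sum_congr rfl fun i hi => ?_
    have hne : a ≠ i := fun h => ha (h ▸ hi)
    rw [Finset.erase_insert_of_ne hne, Finset.prod_insert (fun h => ha (Finset.mem_of_mem_erase h)),
      mul_assoc]

theorem cf_sum {ι : Type*} (s : Finset ι) (f : ι → PA) (nu : Multiset ℕ) :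
    cf (∑ i ∈ s, f i) nu = ∑ i ∈ s, cf (f i) nu := by
  unfold cf
  rw [MvPolynomial.coeff_sum]

theorem hA_const (n : ℕ) (hn : 0 < n) : MvPolynomial.constantCoeff (hA n) = 0 := by
  obtain ⟨n, rfl⟩ : ∃ n', n = n' + 1 := ⟨n - 1, by omega⟩
  rw [hA, map_mul, map_sum]
  simp

theorem val_h {k : ℕ} (nu : Multiset ℕ) (hnu : ∀ i ∈ nu, 0 < i) : ∀ al : Fin k →₀ ℕ,
    (zMult nu : ℚ) * cf (∏ i, hA (al i)) nu =
      MvPolynomial.coeff al (evk k (nu.map MvPolynomial.X).prod) := by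
  induction nu using Multiset.induction_on with
  | empty =>
    intro al
    have h0 : zMult 0 = 1 := by simp [zMult]
    rw [h0, Nat.cast_one, one_mul]
    unfold cf
    rw [map_zero, ← MvPolynomial.constantCoeff_eq, map_prod]
    rw [Multiset.map_zero, Multiset.prod_zero, map_one, MvPolynomial.coeff_one]
    by_cases h : 0 = al
    · rw [if_pos h, ← h]
      simp [hA_zero]
    · rw [if_neg h]
      obtain ⟨i, hi⟩ : ∃ i, al i ≠ 0 := by
        by_contra hc
        push Not at hc
        apply h
        ext i
        exact (hc i).symm
      exact Finset.prod_eq_zero (Finset.mem_univ i) (hA_const _ (by omega))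
  | cons n nu ih =>
    intro al
    have hn : 0 < n := hnu n (Multiset.mem_cons_self _ _)
    have ih' := ih (fun i hi => hnu i (Multiset.mem_cons_of_mem hi))
    rw [val_cons, Dk_prod, cf_sum, Finset.mul_sum, Multiset.map_cons, Multiset.prod_cons, map_mul, evk_X,
      Finset.sum_mul, MvPolynomial.coeff_sum]
    refine Finset.sum_congr rfl fun i _ => ?_
    rw [Dk_hA n hn, MvPolynomial.X_pow_eq_monomial, MvPolynomial.coeff_monomial_mul']
    have hle : Finsupp.single i n ≤ al ↔ n ≤ al i := by
      rw [Finsupp.single_le_iff]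
    by_cases h : n ≤ al i
    · rw [if_pos h, if_pos (hle.2 h), one_mul, ← ih']
      congr 2
      rw [← Finset.mul_prod_erase _ _ (Finset.mem_univ i), mul_comm]
      congr 1
      · simp
      · refine Finset.prod_congr rfl fun j hj => ?_
        rw [Finsupp.tsub_apply, Finsupp.single_eq_of_ne (Finset.ne_of_mem_erase hj), Nat.sub_zero]
    · rw [if_neg h, if_neg (fun hc => h (hle.1 hc)), mul_zero]
      simp [cf]

theorem coeff_Mcount (lam nu : Multiset ℕ) :
    MvPolynomial.coeff (Finsupp.equivFunOnFinite.symm (pf lam))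
      (evk (Multiset.card lam) (nu.map MvPolynomial.X).prod) = (Mcount lam nu : ℚ) := by
  conv_lhs => rw [← pf_map nu]
  rw [Multiset.map_map, map_multiset_prod, Multiset.map_map]
  change MvPolynomial.coeff _ (∏ j, evk _ (MvPolynomial.X (pf nu j))) = _
  simp_rw [evk_X]
  rw [Finset.prod_univ_sum, MvPolynomial.coeff_sum, Fintype.piFinset_univ, Mcount_eq, Fintype.card_subtype,
    Finset.card_filter]
  push_cast
  refine Finset.sum_congr rfl fun f _ => ?_
  simp_rw [MvPolynomial.X_pow_eq_monomial]
  rw [← MvPolynomial.monomial_sum_one, MvPolynomial.coeff_monomial]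
  refine if_congr ?_ rfl rfl
  rw [Finsupp.ext_iff]
  refine forall_congr' fun i => ?_
  rw [Finsupp.finsetSum_apply, Finset.sum_filter]
  simp only [Finsupp.equivFunOnFinite_symm_apply_apply, Finsupp.single_apply]

/-- pairing with `h_mu`: coefficient of `x^mu` -/
def pr (mu : Multiset ℕ) (f : PA) : ℚ :=
  MvPolynomial.coeff (Finsupp.equivFunOnFinite.symm (pf mu)) (evk (Multiset.card mu) f)

theorem cf_h (lam nu : Multiset ℕ) (hnu : ∀ i ∈ nu, 0 < i) :
    cf (lam.map hA).prod nu = (zMult nu : ℚ)⁻¹ * (Mcount lam nu : ℚ) := by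
  have h := val_h nu hnu (Finsupp.equivFunOnFinite.symm (pf lam))
  rw [coeff_Mcount] at h
  have e : ∏ i, hA ((Finsupp.equivFunOnFinite.symm (pf lam)) i) = (lam.map hA).prod := by
    conv_rhs => rw [← pf_map lam, Multiset.map_map]
    rfl
  rw [e] at h
  rw [← h, ← mul_assoc, inv_mul_cancel₀ (zMult_ne hnu), one_mul]

theorem prod_X_eq (s : Multiset ℕ) :
    (s.map (MvPolynomial.X : ℕ → PA)).prod = MvPolynomial.monomial (Multiset.toFinsupp s) 1 := by
  induction s using Multiset.induction_on with
  | empty => simp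
  | cons a s ih =>
    rw [Multiset.map_cons, Multiset.prod_cons, ih, ← Multiset.singleton_add, map_add,
      Multiset.toFinsupp_singleton, MvPolynomial.X, MvPolynomial.monomial_mul, one_mul]

theorem Hom_expand {w : ℕ} {f : PA} (hf : f ∈ Hom w) :
    f = ∑ nu : Nat.Partition w, MvPolynomial.C (cf f nu.parts) * (nu.parts.map MvPolynomial.X).prod := by
  obtain ⟨c, hc⟩ := (Submodule.mem_span_range_iff_exists_fun ℚ).1 hf
  have h : ∀ nu : Nat.Partition w, cf f nu.parts = c nu := by
    intro nu
    rw [← hc, cf_sum, Finset.sum_eq_single nu]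
    · rw [cf, prod_X_eq]; simp
    · intro mu _ hne
      rw [cf, prod_X_eq, MvPolynomial.coeff_smul, MvPolynomial.coeff_monomial, if_neg]
      · simp
      · intro h
        exact hne (Nat.Partition.ext (Multiset.toFinsupp.injective h))
    · simp
  simp_rw [h]
  rw [← hc]
  refine Finset.sum_congr rfl fun nu _ => ?_
  rw [MvPolynomial.smul_eq_C_mul]

theorem pr_expand {w : ℕ} {f : PA} (hf : f ∈ Hom w) (mu : Multiset ℕ) :
    pr mu f = ∑ nu : Nat.Partition w, cf f nu.parts * (Mcount mu nu.parts : ℚ) := by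
  conv_lhs => rw [Hom_expand hf]
  unfold pr
  rw [map_sum, MvPolynomial.coeff_sum]
  refine Finset.sum_congr rfl fun nu _ => ?_
  rw [map_mul, evk_C, MvPolynomial.coeff_C_mul, coeff_Mcount]

theorem pr_phi_expand {w : ℕ} {f : PA} (hf : f ∈ Hom w) (l : ℚ) (mu : Multiset ℕ) :
    pr mu (phi l f) = ∑ nu : Nat.Partition w,
      cf f nu.parts * l ^ (Multiset.card nu.parts) * (Mcount mu nu.parts : ℚ) := by
  conv_lhs => rw [Hom_expand hf]
  unfold pr
  rw [map_sum, map_sum, MvPolynomial.coeff_sum]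
  refine Finset.sum_congr rfl fun nu _ => ?_
  have e : phi l (nu.parts.map MvPolynomial.X).prod =
      MvPolynomial.C (l ^ (Multiset.card nu.parts)) * (nu.parts.map MvPolynomial.X).prod := by
    rw [map_multiset_prod, Multiset.map_map]
    have : (⇑(phi l) ∘ MvPolynomial.X) = fun n => MvPolynomial.C l * MvPolynomial.X n := by
      ext1 n; simp [phi_X]
    rw [this, Multiset.prod_map_mul, Multiset.map_const', Multiset.prod_replicate, MvPolynomial.C_pow]
  rw [map_mul, phi_C, e, map_mul, map_mul, evk_C, evk_C, MvPolynomial.coeff_C_mul,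
    MvPolynomial.coeff_C_mul, coeff_Mcount, mul_assoc]

theorem pr_Rm {m : ℤ} {f : PA} (hf : Rm m f) (mu : Multiset ℕ) : ∃ z : ℤ, pr mu f = ((m * z : ℤ) : ℚ) := by
  obtain ⟨g, hg⟩ := hf (Multiset.card mu)
  refine ⟨MvPolynomial.coeff (Finsupp.equivFunOnFinite.symm (pf mu)) g, ?_⟩
  unfold pr
  rw [hg, MvPolynomial.coeff_map, MvPolynomial.coeff_C_mul, eq_intCast]

theorem pr_sub (mu : Multiset ℕ) (f g : PA) : pr mu (f - g) = pr mu f - pr mu g := by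
  unfold pr
  rw [map_sub, MvPolynomial.coeff_sub]

theorem Hom_h {w : ℕ} (lam : Nat.Partition w) : (lam.parts.map hA).prod ∈ Hom w := by
  have : ∀ s : Multiset ℕ, (s.map hA).prod ∈ Hom s.sum := by
    intro s
    induction s using Multiset.induction_on with
    | empty => simpa using Hom_one
    | cons a s ih =>
      rw [Multiset.map_cons, Multiset.prod_cons, Multiset.sum_cons]
      exact Hom_mul (Hom_hA a) ih
  have h := this lam.parts
  rwa [lam.parts_sum] at h

theorem Rm_hprod (l : ℕ) (s : Multiset ℕ) : Rm 1 (phi l (s.map hA).prod) := by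
  induction s using Multiset.induction_on with
  | empty => simpa using Rm_one
  | cons a s ih =>
    rw [Multiset.map_cons, Multiset.prod_cons, map_mul]
    exact Rm_mul' (Rm_phi_one l a) ih (by ring)

theorem Rm_hprod1 (s : Multiset ℕ) : Rm 1 (s.map hA).prod := by
  have := Rm_hprod 1 s
  rwa [Nat.cast_one, phi_one] at this



abbrev qm (ι : Type*) [Fintype ι] [DecidableEq ι] : Matrix ι ι ℤ →+* Matrix ι ι ℚ :=
  (Int.castRingHom ℚ).mapMatrix

theorem qm_inj (ι : Type*) [Fintype ι] [DecidableEq ι] : Function.Injective (qm ι) :=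
  Matrix.map_injective Int.cast_injective

/-- abstract linear algebra step -/
theorem la_step {ι : Type*} [Fintype ι] [DecidableEq ι] (p : ℕ) (hp : p.Prime) (c : ι → ℕ)
    (M H Cu L : Matrix ι ι ℚ) (G Q Y A : Matrix ι ι ℤ)
    (hM : M.det ≠ 0) (hG : qm ι G = H * M.transpose) (hGd : G.det = 1)
    (hP : Cu * M.transpose - H * M.transpose = qm ι ((p : ℤ) • Q))
    (hA : qm ι A = H * L * M.transpose)
    (hY : Cu * L * M.transpose = qm ι (Matrix.diagonal (fun i => (p : ℤ) ^ c i) * Y))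
    (hAd : A.det = (p : ℤ) ^ (∑ i, c i)) :
    ∃ (e : ι ≃ ι) (U V : Matrix ι ι ℤ), IsUnit U ∧ IsUnit V ∧
      U * A * V = Matrix.diagonal (fun i => (p : ℤ) ^ c (e i)) := by
  have : Fact p.Prime := ⟨hp⟩
  obtain ⟨P, hPd⟩ : ∃ P, P = G + (p : ℤ) • Q := ⟨_, rfl⟩
  have hPq : qm ι P = Cu * M.transpose := by
    rw [hPd, map_add, ← hP, hG]
    abel
  have hadj : G.adjugate * G = 1 := by rw [Matrix.adjugate_mul, hGd, one_smul]
  have hadjd : G.adjugate.det = 1 := by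
    have := congrArg Matrix.det hadj
    rwa [Matrix.det_mul, hGd, mul_one, Matrix.det_one] at this
  have hTG : P * G.adjugate * G = P := by rw [mul_assoc, hadj, mul_one]
  have hMu : IsUnit M.transpose := by
    rw [Matrix.isUnit_iff_isUnit_det, Matrix.det_transpose]
    exact isUnit_iff_ne_zero.2 hM
  have hTH : qm ι (P * G.adjugate) * H = Cu := by
    apply hMu.mul_right_cancel
    rw [mul_assoc, ← hG, ← map_mul, hTG, hPq]
  apply la_main p hp A (P * G.adjugate) Y c
  · apply qm_inj
    rw [← hY, map_mul, hA, ← hTH]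
    simp only [mul_assoc]
  · rw [Matrix.det_mul, hadjd, mul_one]
    intro hdvd
    have h0 : ((P.det : ℤ) : ZMod p) = 0 := (ZMod.intCast_zmod_eq_zero_iff_dvd _ _).2 hdvd
    have h1 : ((P.det : ℤ) : ZMod p) = ((G.det : ℤ) : ZMod p) := by
      have e1 := RingHom.map_det (Int.castRingHom (ZMod p)) P
      have e2 := RingHom.map_det (Int.castRingHom (ZMod p)) G
      rw [eq_intCast] at e1 e2
      rw [e1, e2]
      congr 1
      ext i j
      rw [hPd]
      simp only [RingHom.mapMatrix_apply, Matrix.map_apply, Matrix.add_apply, Matrix.smul_apply,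
        smul_eq_mul, eq_intCast, Int.cast_add, Int.cast_mul, Int.cast_natCast, ZMod.natCast_self,
        zero_mul, add_zero]
    rw [h1, hGd, Int.cast_one] at h0
    exact one_ne_zero h0
  · exact hAd

def Mq (w : ℕ) : Matrix (Nat.Partition w) (Nat.Partition w) ℚ :=
  Matrix.of fun lam nu => (Mcount lam.parts nu.parts : ℚ)

def Ziq (w : ℕ) : Matrix (Nat.Partition w) (Nat.Partition w) ℚ :=
  Matrix.diagonal fun nu => (zMult nu.parts : ℚ)⁻¹

def Lq (l : ℚ) (w : ℕ) : Matrix (Nat.Partition w) (Nat.Partition w) ℚ :=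
  Matrix.diagonal fun nu => l ^ (Multiset.card nu.parts)

theorem Mq_det (w : ℕ) : (Mq w).det =
    ((∏ lam : Nat.Partition w, ∏ j ∈ lam.parts.toFinset, (lam.parts.count j).factorial : ℕ) : ℚ) := by
  rw [la_tri (Mq w) (fun mu => Multiset.card mu.parts)]
  · push_cast
    refine Finset.prod_congr rfl fun lam _ => ?_
    simp only [Mq, Matrix.of_apply]
    rw [Mc_diag _ (fun i hi => lam.parts_pos hi)]
    push_cast
    rfl
  · intro lam mu hne h
    simp only [Mq, Matrix.of_apply] at h
    exact Mc_tri _ _ (fun i hi => lam.parts_pos hi) (fun hc => hne (Nat.Partition.ext hc))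
      (by exact_mod_cast h)

theorem Mq_det_ne (w : ℕ) : (Mq w).det ≠ 0 := by
  rw [Mq_det, Nat.cast_ne_zero, Finset.prod_ne_zero_iff]
  intro lam _
  rw [Finset.prod_ne_zero_iff]
  intro j _
  exact Nat.factorial_ne_zero _

theorem MZM_det (w : ℕ) : (Mq w * Ziq w * (Mq w).transpose).det = 1 := by
  rw [Matrix.det_mul, Matrix.det_mul, Matrix.det_transpose]
  have hz : (Ziq w).det = ((Mq w).det * (Mq w).det)⁻¹ := by
    rw [Ziq, Matrix.det_diagonal, Finset.prod_inv_distrib, Mq_det]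
    congr 1
    rw [← Nat.cast_mul]
    rw [← Nat.cast_prod]
    congr 1
    conv_rhs => rw [pt_fact]
    conv_rhs => rw [← pt_fact w]
    nth_rewrite 1 [pt_fact w]
    rw [← Finset.prod_mul_distrib]
    refine Finset.prod_congr rfl fun lam _ => ?_
    rw [← Finset.prod_mul_distrib]
    rfl
  rw [hz]
  have := Mq_det_ne w
  field_simp

theorem MZLM_det (p : ℕ) (hp : p.Prime) (r w : ℕ) :
    (Mq w * Ziq w * Lq ((p : ℚ) ^ r) w * (Mq w).transpose).det =
      (p : ℚ) ^ (∑ lam : Nat.Partition w, cpr p r lam.parts) := by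
  have h := MZM_det w
  rw [Matrix.det_mul] at h
  rw [Matrix.det_mul, Matrix.det_mul, mul_right_comm, h, one_mul, Lq, Matrix.det_diagonal]
  have := pt_cpr p hp r w
  rw [Finset.prod_pow_eq_pow_sum] at this
  exact_mod_cast this.symm

theorem Xmat_eq (l : ℤ) (w : ℕ) : Xmat l w =
    qm _ (jtM w) * (Mq w * Ziq w * Lq l w * (Mq w).transpose) * (qm _ (jtM w)).transpose := by
  have hS : ∀ lam nu : Nat.Partition w, (qm _ (jtM w) * Mq w) lam nu = sval lam.parts nu.parts := by
    intro lam nu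
    rw [Matrix.mul_apply, jt_sval]
    rfl
  have : qm _ (jtM w) * (Mq w * Ziq w * Lq l w * (Mq w).transpose) * (qm _ (jtM w)).transpose
      = (qm _ (jtM w) * Mq w) * (Ziq w * Lq l w) * (qm _ (jtM w) * Mq w).transpose := by
    rw [Matrix.transpose_mul]
    simp only [mul_assoc]
  rw [this]
  ext lam mu
  rw [Matrix.mul_apply, Xmat, Matrix.of_apply]
  refine Finset.sum_congr rfl fun nu _ => ?_
  rw [Ziq, Lq, Matrix.diagonal_mul_diagonal, Matrix.mul_diagonal, Matrix.transpose_apply, hS, hS]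
  ring

theorem main_A (p : ℕ) (hp : p.Prime) (r w : ℕ) :
    ∃ A : Matrix (Nat.Partition w) (Nat.Partition w) ℤ,
      qm _ A = Mq w * Ziq w * Lq ((p : ℚ) ^ r) w * (Mq w).transpose ∧
      ∃ (e : Nat.Partition w ≃ Nat.Partition w) (U V : Matrix (Nat.Partition w) (Nat.Partition w) ℤ),
        IsUnit U ∧ IsUnit V ∧
        U * A * V = Matrix.diagonal (fun i => (p : ℤ) ^ cpr p r (e i).parts) := by
  choose u hu1 hu2 hu3 using fun lam : Nat.Partition w => exists_u hp r lam
  have hH : ∀ lam nu : Nat.Partition w, cf (lam.parts.map hA).prod nu.parts = (Mq w * Ziq w) lam nu := by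
    intro lam nu
    rw [cf_h _ _ (fun i hi => nu.parts_pos hi), Ziq, Matrix.mul_diagonal, Mq, Matrix.of_apply, mul_comm]
  have hG0 : ∀ lam mu : Nat.Partition w, ∃ z : ℤ, pr mu.parts (lam.parts.map hA).prod = z := by
    intro lam mu
    obtain ⟨z, hz⟩ := pr_Rm (Rm_hprod1 lam.parts) mu.parts
    exact ⟨z, by rw [hz, one_mul]⟩
  choose G hG using hG0
  have hA0 : ∀ lam mu : Nat.Partition w, ∃ z : ℤ,
      pr mu.parts (phi ((p : ℚ) ^ r) (lam.parts.map hA).prod) = z := by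
    intro lam mu
    obtain ⟨z, hz⟩ := pr_Rm (Rm_hprod (p ^ r) lam.parts) mu.parts
    push_cast at hz
    exact ⟨z, by rw [hz, one_mul]⟩
  choose A hA' using hA0
  choose Q hQ using fun lam mu : Nat.Partition w => pr_Rm (hu2 lam) mu.parts
  choose Y hY using fun lam mu : Nat.Partition w => pr_Rm (hu3 lam) mu.parts
  have hAq : qm _ (Matrix.of A) = Mq w * Ziq w * Lq ((p : ℚ) ^ r) w * (Mq w).transpose := by
    ext lam mu
    rw [Matrix.mul_apply]
    refine Eq.trans (hA' lam mu).symm ?_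
    rw [pr_phi_expand (Hom_h lam)]
    refine Finset.sum_congr rfl fun nu _ => ?_
    rw [hH, Lq, Matrix.mul_diagonal]
    rfl
  refine ⟨Matrix.of A, hAq, ?_⟩
  have hGq : qm _ (Matrix.of G) = Mq w * Ziq w * (Mq w).transpose := by
    ext lam mu
    rw [Matrix.mul_apply]
    refine Eq.trans (hG lam mu).symm ?_
    rw [pr_expand (Hom_h lam)]
    refine Finset.sum_congr rfl fun nu _ => ?_
    rw [hH]
    rfl
  refine la_step p hp (fun lam : Nat.Partition w => cpr p r lam.parts) (Mq w) (Mq w * Ziq w)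
    (Matrix.of fun lam nu => cf (u lam) nu.parts) (Lq ((p : ℚ) ^ r) w)
    (Matrix.of G) (Matrix.of Q) (Matrix.of Y) (Matrix.of A) (Mq_det_ne w) hGq ?_ ?_ hAq ?_ ?_
  · have h1 := RingHom.map_det (Int.castRingHom ℚ) (Matrix.of G)
    change _ = (qm _ (Matrix.of G)).det at h1
    rw [hGq, MZM_det, eq_intCast] at h1
    exact_mod_cast h1
  · ext lam mu
    rw [Matrix.sub_apply, ← hGq, Matrix.mul_apply]
    have h1 := hQ lam mu
    rw [pr_sub, pr_expand (hu1 lam), hG] at h1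
    refine Eq.trans h1 ?_
    simp
  · ext lam mu
    have h1 := hY lam mu
    rw [pr_phi_expand (hu1 lam)] at h1
    have h2 : (Matrix.diagonal (fun i : Nat.Partition w => (p : ℤ) ^ cpr p r i.parts) * Matrix.of Y) lam mu
        = (p : ℤ) ^ cpr p r lam.parts * Y lam mu := by
      rw [Matrix.diagonal_mul]; rfl
    rw [RingHom.mapMatrix_apply, Matrix.map_apply, h2, eq_intCast, ← h1, Matrix.mul_apply]
    refine Finset.sum_congr rfl fun nu _ => ?_
    rw [Lq, Matrix.mul_diagonal]
    rfl
  · have h1 := RingHom.map_det (Int.castRingHom ℚ) (Matrix.of A)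
    change _ = (qm _ (Matrix.of A)).det at h1
    rw [hAq, MZLM_det p hp, eq_intCast] at h1
    exact_mod_cast h1

/-- **Theorem 1.3 (Hill's conjecture).** Let `p` be a prime and `r ≥ 0`. The elementary
divisors of `X^{(s,s)}_{p^r, w}` are `p^{c_{p,r}(λ)}`, `λ ∈ Par(w)`. -/
theorem X_elementary_divisors (p : ℕ) (hp : p.Prime) (r w : ℕ) :
    IntEquiv (Xmat ((p : ℤ) ^ r) w)
      (Matrix.diagonal (fun lam : Nat.Partition w => ((p : ℚ) ^ cpr p r lam.parts))) := by
  obtain ⟨A, hA', e, U, V, hU, hV, h⟩ := main_A p hp r w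
  have hJ1 : (jtM w).adjugate * jtM w = 1 := by rw [Matrix.adjugate_mul, jt_det, one_smul]
  have hJ2 : jtM w * (jtM w).adjugate = 1 := by rw [Matrix.mul_adjugate, jt_det, one_smul]
  have hJu : IsUnit (jtM w).adjugate := ⟨⟨(jtM w).adjugate, jtM w, hJ1, hJ2⟩, rfl⟩
  have hJ3 : (jtM w).transpose * (jtM w).adjugate.transpose = 1 := by
    rw [← Matrix.transpose_mul, hJ1, Matrix.transpose_one]
  have hJ4 : (jtM w).adjugate.transpose * (jtM w).transpose = 1 := by
    rw [← Matrix.transpose_mul, hJ2, Matrix.transpose_one]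
  have hJt : IsUnit (jtM w).adjugate.transpose :=
    ⟨⟨(jtM w).adjugate.transpose, (jtM w).transpose, hJ4, hJ3⟩, rfl⟩
  refine ⟨e, U * (jtM w).adjugate, (jtM w).adjugate.transpose * V, hU.mul hJu, hJt.mul hV, ?_⟩
  have hX : Xmat ((p : ℤ) ^ r) w = qm _ (jtM w * A * (jtM w).transpose) := by
    rw [Xmat_eq, map_mul, map_mul, hA']
    push_cast
    rfl
  change qm _ (U * (jtM w).adjugate) * Xmat ((p : ℤ) ^ r) w * qm _ ((jtM w).adjugate.transpose * V) = _
  rw [hX, ← map_mul, ← map_mul]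
  have h2 : U * (jtM w).adjugate * (jtM w * A * (jtM w).transpose) * ((jtM w).adjugate.transpose * V)
      = U * A * V := by
    calc _ = U * ((jtM w).adjugate * jtM w) * A * ((jtM w).transpose * (jtM w).adjugate.transpose) * V := by
          simp only [mul_assoc]
      _ = U * A * V := by rw [hJ1, hJ3, mul_one, mul_one]
  rw [h2, h, Matrix.submatrix_diagonal_equiv]
  ext i j
  by_cases hij : i = j
  · subst hij; simp
  · simp [hij]

end
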